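/- arXiv:1005.2863 — 2 statements merged into one kernel-verified Lean document; each statement's English description precedes it below -/
import Mathlib

section
/- There exist a constant c > 0 and N such that for all n ≥ N, the number of P ∈ 𝓟(n) such that G(P) is blue-bipartite but not triangle-connected is at most 2^{−c·n}·b(n), where b(n)=2^{n(n+1)/2−1}. -/
open Filter

noncomputable section

/-- A colored graph on `Fin n`: a simple graph whose edges are partitioned
into red and blue edges. -/
structure ColoredGraph (n : ℕ) where
  red : SimpleGraph (Fin n)
  blue : SimpleGraph (Fin n)
  disj : ∀ x y, ¬ (red.Adj x y ∧ blue.Adj x y)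

namespace ColoredGraph

variable {n : ℕ}

/-- The underlying (uncolored) simple graph. -/
def graph (G : ColoredGraph n) : SimpleGraph (Fin n) := G.red ⊔ G.blue

/-- Adjacency in a colored graph. -/
def Adj (G : ColoredGraph n) (x y : Fin n) : Prop := G.graph.Adj x y

/-- The neighborhood of a vertex. -/
def nbhd (G : ColoredGraph n) (x : Fin n) : Set (Fin n) := {y | G.Adj x y}

/-- `Γ(Q)`, the external neighborhood of a set of vertices. -/
def nbhdSet (G : ColoredGraph n) (Q : Set (Fin n)) : Set (Fin n) :=
  (⋃ x ∈ Q, G.nbhd x) \ Q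

/-- The degree of a vertex. -/
def deg (G : ColoredGraph n) (x : Fin n) : ℕ := (G.nbhd x).ncard

open scoped Classical in
/-- Indicator that the edge `xy` is blue. -/
def blueInd (G : ColoredGraph n) (x y : Fin n) : ℕ := if G.blue.Adj x y then 1 else 0

/-- Odd-blue-triangle-free: no triangle with an odd number of blue edges. -/
def OBTF (G : ColoredGraph n) : Prop :=
  ∀ x y z : Fin n, G.Adj x y → G.Adj y z → G.Adj x z →
    ¬ Odd (G.blueInd x y + G.blueInd y z + G.blueInd x z)

/-- The colored graph induced on the vertex set `A` is blue-bipartite: there is a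
partition `U ⊔ (A \ U)` of `A` such that blue edges within `A` cross the partition
and red edges within `A` do not. -/
def BlueBipartiteOn (G : ColoredGraph n) (A : Set (Fin n)) : Prop :=
  ∃ U ⊆ A, ∀ x ∈ A, ∀ y ∈ A,
    (G.blue.Adj x y → (x ∈ U ↔ y ∉ U)) ∧ (G.red.Adj x y → (x ∈ U ↔ y ∈ U))

/-- Blue-bipartite colored graph. -/
def BlueBipartite (G : ColoredGraph n) : Prop := G.BlueBipartiteOn Set.univ

/-- `κ(G)`: the minimum size of a vertex set whose removal leaves a blue-bipartite graph. -/
def kappa (G : ColoredGraph n) : ℕ :=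
  sInf {k | ∃ K : Set (Fin n), K.ncard = k ∧ G.BlueBipartiteOn Kᶜ}

end ColoredGraph

/-- `𝓕(n)`: the set of OBTF colored graphs on `[n]`. -/
def obtfSet (n : ℕ) : Set (ColoredGraph n) := {G | G.OBTF}

/-- `F(n) = |𝓕(n)|`. -/
def Fnum (n : ℕ) : ℕ := (obtfSet n).ncard

/-- `𝓑(n)`: the set of blue-bipartite colored graphs on `[n]`. -/
def bbSet (n : ℕ) : Set (ColoredGraph n) := {G | G.BlueBipartite}

/-- `|𝓑(n)|`. -/
def Bnum (n : ℕ) : ℕ := (bbSet n).ncard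

/-- `b(n) = 2^{n(n+1)/2 - 1}`. -/
def bnum (n : ℕ) : ℕ := 2 ^ (n * (n + 1) / 2 - 1)

/-- The type of `2n` literals: `(i, false)` is `xᵢ` and `(i, true)` is `x̄ᵢ`. -/
abbrev Lit (n : ℕ) := Fin n × Bool

/-- Negation of a literal. -/
def Lit.bar {n : ℕ} (u : Lit n) : Lit n := (u.1, !u.2)

/-- `𝓟(n)`: partial orders on the `2n` literals in which `xᵢ` and `x̄ᵢ` are
incomparable for every `i`, and `u ≤ v` iff `v̄ ≤ ū`. -/
def LitPoset (n : ℕ) : Type :=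
  {r : Lit n → Lit n → Prop //
    IsPartialOrder (Lit n) r ∧ (∀ (i : Fin n) (b : Bool), ¬ r (i, b) (i, !b)) ∧
    ∀ u v : Lit n, r u v ↔ r v.bar u.bar}

/-- The covering relation `u ⋖ v` of a partial order `r`. -/
def Covers {n : ℕ} (r : Lit n → Lit n → Prop) (u v : Lit n) : Prop :=
  u ≠ v ∧ r u v ∧ ∀ z : Lit n, r u z → r z v → z = u ∨ z = v

/-- `G` is the colored graph `G(P)` of the poset `P`: red edges `ij` come from covers
`xᵢ ⋖ x̄ⱼ` or `x̄ᵢ ⋖ xⱼ`, and blue edges `ij` from covers `xᵢ ⋖ xⱼ` or `x̄ᵢ ⋖ x̄ⱼ`. -/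
def GraphOf {n : ℕ} (P : LitPoset n) (G : ColoredGraph n) : Prop :=
  ∀ i j : Fin n,
    (G.red.Adj i j ↔ i ≠ j ∧
      (Covers P.1 (i, false) (j, true) ∨ Covers P.1 (i, true) (j, false))) ∧
    (G.blue.Adj i j ↔ i ≠ j ∧
      (Covers P.1 (i, false) (j, false) ∨ Covers P.1 (i, true) (j, true)))

/-- `𝓟(G) = {P ∈ 𝓟(n) : G(P) = G}`. -/
def PsetOf {n : ℕ} (G : ColoredGraph n) : Set (LitPoset n) := {P | GraphOf P G}

/-- `T = (a, b, c)` is a triangle of `G`. -/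
def IsTri {n : ℕ} (G : ColoredGraph n) (T : Fin n × Fin n × Fin n) : Prop :=
  G.Adj T.1 T.2.1 ∧ G.Adj T.2.1 T.2.2 ∧ G.Adj T.1 T.2.2

/-- `e` is an edge of the triangle `T`. -/
def EdgeOf {n : ℕ} (e : Sym2 (Fin n)) (T : Fin n × Fin n × Fin n) : Prop :=
  e = s(T.1, T.2.1) ∨ e = s(T.2.1, T.2.2) ∨ e = s(T.1, T.2.2)

/-- Edges `e, f` are triangle-equivalent: `e = f` or there is a sequence
`T₀, …, T_l` of triangles with `e` an edge of `T₀`, `f` an edge of `T_l`, and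
consecutive triangles sharing an edge. -/
def TriEquiv {n : ℕ} (G : ColoredGraph n) (e f : Sym2 (Fin n)) : Prop :=
  e = f ∨ ∃ (l : ℕ) (T : ℕ → Fin n × Fin n × Fin n),
    (∀ i ≤ l, IsTri G (T i)) ∧ EdgeOf e (T 0) ∧ EdgeOf f (T l) ∧
    ∀ i < l, ∃ g : Sym2 (Fin n), EdgeOf g (T i) ∧ EdgeOf g (T (i + 1))

/-- `η(G)`: the number of triangle-components of `G`, i.e. of classes of edges under
triangle-equivalence. -/
def eta {n : ℕ} (G : ColoredGraph n) : ℕ :=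
  Nat.card (Quot (fun e f : G.graph.edgeSet => TriEquiv G e.1 f.1))

/-- `G` is triangle-connected: all pairs of its edges are triangle-equivalent. -/
def TriConnected {n : ℕ} (G : ColoredGraph n) : Prop :=
  ∀ e ∈ G.graph.edgeSet, ∀ f ∈ G.graph.edgeSet, TriEquiv G e f

namespace FNT

open Finset

/-- A valid edge colouring: symmetric, empty diagonal, all triangles monochromatic. -/
def Valid {V : Type} (c : V → V → Option Bool) : Prop :=
  (∀ x y, c x y = c y x) ∧ (∀ x, c x x = none) ∧
  ∀ x y z a b, c x y = some a → c y z = some b → c x z ≠ none → a = b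

lemma Valid.restrict {V : Type} {c : V → V → Option Bool} (h : Valid c) {W : Type} (f : W → V) :
    Valid (fun x y => c (f x) (f y)) :=
  ⟨fun _ _ => h.1 _ _, fun _ => h.2.1 _, fun _ _ _ a b => h.2.2 _ _ _ a b⟩

/-- weighted counting lemma -/
lemma count_few_bad {ι σ : Type} [Fintype ι] [Fintype σ] (B : σ → Prop) [DecidablePred B]
    (lam : ℝ) (h0 : 0 < lam) (h1 : lam ≤ 1) (k : ℕ) :
    ({s : ι → σ | (univ.filter fun i => B (s i)).card ≤ k}.ncard : ℝ) * lam ^ k ≤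
      (∑ x : σ, if B x then lam else 1) ^ Fintype.card ι := by
  classical
  have e1 : (∑ x : σ, if B x then lam else 1) ^ Fintype.card ι =
      ∑ s : ι → σ, ∏ i, (if B (s i) then lam else 1) := by
    have := Finset.prod_univ_sum (fun _ : ι => (univ : Finset σ))
      (fun _ x => if B x then lam else (1:ℝ))
    rw [Finset.prod_const, Finset.card_univ, Fintype.piFinset_univ] at this
    exact this
  rw [e1]
  have e2 : ∀ s : ι → σ, ∏ i, (if B (s i) then lam else (1:ℝ)) =
      lam ^ (univ.filter fun i => B (s i)).card := by
    intro s
    rw [Finset.prod_ite]; simp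
  simp_rw [e2]
  rw [Set.ncard_eq_toFinset_card']
  calc _ = ∑ s ∈ {s : ι → σ | (univ.filter fun i => B (s i)).card ≤ k}.toFinset, lam ^ k := by
        simp
    _ ≤ ∑ s ∈ {s : ι → σ | (univ.filter fun i => B (s i)).card ≤ k}.toFinset,
          lam ^ (univ.filter fun i => B (s i)).card := by
        apply Finset.sum_le_sum
        intro s hs
        simp at hs
        exact pow_le_pow_of_le_one h0.le h1 hs
    _ ≤ _ := by
        apply Finset.sum_le_sum_of_subset_of_nonneg (Finset.subset_univ _)
        intros; positivity

/-- removal lemma -/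
lemma removal {V ι : Type} [Fintype V] [Fintype ι] (κ : ι → V)
    (S : Set (V → V → Option Bool)) (hS : ∀ c ∈ S, Valid c)
    (T : Set ({u : V // u ∉ Set.range κ} → {u : V // u ∉ Set.range κ} → Option Bool))
    (A : Set ({u : V // u ∉ Set.range κ} → ι → Option Bool))
    (hT : ∀ c ∈ S, (fun x y => c x.1 y.1) ∈ T)
    (hA : ∀ c ∈ S, (fun x i => c x.1 (κ i)) ∈ A) :
    S.ncard ≤ T.ncard * A.ncard * 3 ^ (Fintype.card ι ^ 2) := by
  classical
  have h3 : (Set.univ : Set (ι → ι → Option Bool)).ncard = 3 ^ (Fintype.card ι ^ 2) := by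
    rw [Set.ncard_univ, Nat.card_eq_fintype_card]
    simp [pow_two, pow_mul]
  rw [← h3, ← Set.ncard_prod, ← Set.ncard_prod]
  apply Set.ncard_le_ncard_of_injOn
    (fun c => (((fun x y => c x.1 y.1), (fun x i => c x.1 (κ i))), (fun i j => c (κ i) (κ j))))
  · intro c hc
    exact ⟨⟨hT c hc, hA c hc⟩, trivial⟩
  · intro c hc d hd hcd
    simp only [Prod.mk.injEq] at hcd
    obtain ⟨⟨e1, e2⟩, e3⟩ := hcd
    funext x y
    by_cases hx : x ∈ Set.range κ <;> by_cases hy : y ∈ Set.range κ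
    · obtain ⟨i, rfl⟩ := hx
      obtain ⟨j, rfl⟩ := hy
      exact congrFun (congrFun e3 i) j
    · obtain ⟨i, rfl⟩ := hx
      rw [(hS c hc).1, (hS d hd).1]
      exact congrFun (congrFun e2 ⟨y, hy⟩) i
    · obtain ⟨j, rfl⟩ := hy
      exact congrFun (congrFun e2 ⟨x, hx⟩) j
    · exact congrFun (congrFun e1 ⟨x, hx⟩) ⟨y, hy⟩

/-- weak Kővári–Sós–Turán -/
lemma kst (t : ℕ) : ∃ N : ℕ, ∀ (V : Type) [Fintype V], N ≤ Fintype.card V →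
    ∀ R : V → V → Prop, (∀ x, ¬ R x x) →
      Fintype.card V ^ 2 ≤ 200 * {p : V × V | R p.1 p.2}.ncard →
      ∃ κ : Fin t ⊕ Fin t → V, Function.Injective κ ∧ ∀ i j, R (κ (Sum.inl i)) (κ (Sum.inr j)) := by
  classical
  refine ⟨400 * (800 * (t+1)) + 800 * (800 * (t+1)) * (2 ^ (800 * (t+1))) * (t+1) + 1, ?_⟩
  intro V _ hN R hR hcard
  set n := Fintype.card V with hn
  set L := 800 * (t + 1) with hL
  set d : V → ℕ := fun v => (univ.filter fun y => R v y).card with hd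
  have hsum : {p : V × V | R p.1 p.2}.ncard = ∑ v, d v := by
    rw [Set.ncard_eq_toFinset_card']
    simp only [hd, Finset.card_filter]
    rw [← Finset.sum_product', Finset.univ_product_univ, ← Finset.card_filter]
    congr 1; ext; simp
  -- many vertices of large degree
  set D := univ.filter fun v => n ≤ 400 * d v with hD
  have hDc : n ≤ 400 * D.card := by
    have h1 : ∑ v, d v ≤ D.card * n + ∑ v ∈ univ.filter (fun v => ¬ (n ≤ 400 * d v)), d v := by
      rw [← Finset.sum_filter_add_sum_filter_not univ (fun v => n ≤ 400 * d v)]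
      gcongr
      rw [← smul_eq_mul]
      apply Finset.sum_le_card_nsmul
      intro v _
      exact Finset.card_le_univ _
    have h2 : 400 * ∑ v ∈ univ.filter (fun v => ¬ (n ≤ 400 * d v)), d v ≤ n * n := by
      rw [Finset.mul_sum]
      calc _ ≤ ∑ v ∈ univ.filter (fun v => ¬ (n ≤ 400 * d v)), n := by
            apply Finset.sum_le_sum
            intro v hv
            simp at hv; omega
        _ ≤ n * n := by
            rw [Finset.sum_const, smul_eq_mul]
            gcongr
            exact Finset.card_le_univ _
    rw [hsum] at hcard
    have hn0 : 0 < n := by omega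
    nlinarith
  have hLD : L ≤ D.card := by omega
  obtain ⟨E, hED, hEc⟩ := Finset.exists_subset_card_eq hLD
  -- vertices with many neighbours in E
  set e : V → ℕ := fun y => (E.filter fun v => R v y).card with he
  set Y := univ.filter fun y => t ≤ e y with hY
  have hE2 : L * n ≤ 400 * ∑ y, e y := by
    have : ∑ y, e y = ∑ v ∈ E, d v := by
      simp only [he, hd, Finset.card_filter]
      rw [Finset.sum_comm]
    rw [this, Finset.mul_sum]
    calc L * n = ∑ v ∈ E, n := by rw [Finset.sum_const, hEc, smul_eq_mul]
      _ ≤ _ := by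
        apply Finset.sum_le_sum
        intro v hv
        have := hED hv
        simpa [hD] using this
  have hYc : n ≤ 800 * L * Y.card := by
    have h1 : ∑ y, e y ≤ Y.card * L + n * t := by
      rw [← Finset.sum_filter_add_sum_filter_not univ (fun y => t ≤ e y)]
      gcongr
      · rw [← smul_eq_mul]
        apply Finset.sum_le_card_nsmul
        intro v _
        rw [← hEc]
        exact Finset.card_le_card (Finset.filter_subset _ _)
      · calc _ ≤ ∑ v ∈ univ.filter (fun y => ¬ (t ≤ e y)), t := by
              apply Finset.sum_le_sum
              intro v hv
              simp at hv; omega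
          _ ≤ n * t := by
            rw [Finset.sum_const, smul_eq_mul]
            gcongr
            exact Finset.card_le_univ _
    have : L * n = 800 * (n * t) + 800 * n := by rw [hL]; ring
    nlinarith
  have hpig : ∃ F ∈ E.powerset, t + 1 ≤ (Y.filter fun y => (E.filter fun v => R v y) = F).card := by
    apply Finset.exists_le_card_fiber_of_mul_le_card_of_maps_to
    · intro y _
      simp
    · exact ⟨∅, by simp⟩
    · rw [Finset.card_powerset, hEc]
      by_contra hlt
      push Not at hlt
      have : 800 * L * Y.card ≤ 800 * L * (2 ^ L * (t + 1)) := by gcongr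
      have h3 : 800 * L * (2 ^ L * (t + 1)) = 800 * L * 2 ^ L * (t+1) := by ring
      omega
  obtain ⟨F, hF, hFc⟩ := hpig
  have hFt : t ≤ F.card := by
    have : (Y.filter fun y => (E.filter fun v => R v y) = F).Nonempty := by
      rw [← Finset.card_pos]; omega
    obtain ⟨y, hy⟩ := this
    simp only [Finset.mem_filter, hY] at hy
    rw [← hy.2]; exact hy.1.2
  obtain ⟨P, hP, hPc⟩ := Finset.exists_subset_card_eq hFt
  obtain ⟨Q, hQ, hQc⟩ := Finset.exists_subset_card_eq (by omega : t ≤ _ ) (s := (Y.filter fun y => (E.filter fun v => R v y) = F))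
  have hPQ : ∀ p ∈ P, ∀ q ∈ Q, R p q := by
    intro p hp q hq
    have h1 := hQ hq
    have h2 := hP hp
    simp only [Finset.mem_filter] at h1
    rw [← h1.2] at h2
    simpa using (Finset.mem_filter.1 h2).2
  let eP := P.equivFinOfCardEq hPc
  let eQ := Q.equivFinOfCardEq hQc
  refine ⟨Sum.elim (fun i => (eP.symm i).1) (fun j => (eQ.symm j).1), ?_, ?_⟩
  · apply Function.Injective.sumElim
    · exact Subtype.val_injective.comp eP.symm.injective
    · exact Subtype.val_injective.comp eQ.symm.injective
    · intro i j h
      apply hR (eP.symm i).1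
      have := hPQ _ (eP.symm i).2 _ (eQ.symm j).2
      rwa [← h] at this
  · intro i j
    exact hPQ _ (eP.symm i).2 _ (eQ.symm j).2

/-- number of `a`-monochromatic colourings -/
lemma count_mono {V : Type} [Fintype V] (a : Bool) :
    {c : V → V → Option Bool | Valid c ∧ ∀ x y, c x y ≠ some a}.ncard ≤
      2 ^ (Fintype.card V).choose 2 := by
  classical
  rw [← Sym2.card_subtype_not_diag, ← Fintype.card_set, ← Nat.card_eq_fintype_card,
    ← Set.ncard_univ]
  apply Set.ncard_le_ncard_of_injOn
    (fun c => {e | ∃ x y, e.1 = s(x, y) ∧ c x y ≠ none})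
  · intros; trivial
  · intro c hc d hd hcd
    have key : ∀ x y, x ≠ y → (c x y ≠ none ↔ d x y ≠ none) := by
      intro x y hxy
      have h2 : ∀ c : V → V → Option Bool, Valid c →
          ((∃ x' y', s(x, y) = s(x', y') ∧ c x' y' ≠ none) ↔ c x y ≠ none) := by
        intro c hc
        constructor
        · rintro ⟨x', y', h, h'⟩
          rw [Sym2.eq_iff] at h
          rcases h with ⟨rfl, rfl⟩ | ⟨rfl, rfl⟩
          · exact h'
          · rwa [hc.1]
        · intro h; exact ⟨x, y, rfl, h⟩
      have h1 := Set.ext_iff.1 hcd ⟨s(x, y), by simpa using hxy⟩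
      simp only [Set.mem_ofPred_eq] at h1
      rwa [h2 c hc.1, h2 d hd.1] at h1
    funext x y
    by_cases hxy : x = y
    · subst hxy; rw [hc.1.2.1, hd.1.2.1]
    · have h1 := key x y hxy
      have h2 := hc.2 x y
      have h3 := hd.2 x y
      rcases hx : c x y with _ | b <;> rcases hy : d x y with _ | b' <;> simp_all
      cases a <;> cases b <;> cases b' <;> simp_all

end FNT

namespace FNT

open Finset

lemma card_restrict {V ι : Type} [Fintype V] [Fintype ι] [DecidableEq V] (κ : ι → V)
    (hκ : Function.Injective κ) (X : Finset V) [Fintype {u : V // u ∉ Set.range κ}] :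
    (univ.filter fun u : {u : V // u ∉ Set.range κ} => u.1 ∈ X).card +
      (univ.filter fun i => κ i ∈ X).card = X.card := by
  classical
  rw [← Finset.card_filter_add_card_filter_not (s := X) (fun u => u ∉ Set.range κ)]
  congr 1
  · apply Finset.card_bij (fun u _ => u.1)
    · intro u hu
      have := u.2
      simp at hu this ⊢
      exact ⟨hu, this⟩
    · intro a _ b _ h
      exact Subtype.ext h
    · intro b hb
      rw [Finset.mem_filter] at hb
      exact ⟨⟨b, hb.2⟩, by simpa using hb.1, rfl⟩
  · apply Finset.card_bij (fun i _ => κ i)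
    · intro i hi
      simp at hi ⊢
      exact hi
    · intro a _ b _ h
      exact hκ h
    · intro b hb
      rw [Finset.mem_filter, not_not] at hb
      obtain ⟨hb, i, rfl⟩ := hb
      exact ⟨i, by simpa using hb, rfl⟩

lemma card_compl_range {V ι : Type} [Fintype V] [Fintype ι] (κ : ι → V)
    (hκ : Function.Injective κ) [Fintype {u : V // u ∉ Set.range κ}] :
    Fintype.card {u : V // u ∉ Set.range κ} + Fintype.card ι = Fintype.card V := by
  classical
  have := card_restrict κ hκ univ
  simpa using this

/-- Possible attachments to a monochromatic `K_{t,t}`. -/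
def Att (t : ℕ) (a : Bool) : Set (Fin t ⊕ Fin t → Option Bool) :=
  {s | (∀ i, s i ≠ some !a) ∨ (∀ i, s (Sum.inl i) = none) ∨ (∀ j, s (Sum.inr j) = none)}

lemma mem_att {V : Type} {c : V → V → Option Bool} (hc : Valid c) (t : ℕ) (a : Bool)
    (κ : Fin t ⊕ Fin t → V) (hκ : ∀ i j, c (κ (Sum.inl i)) (κ (Sum.inr j)) = some a) (u : V) :
    (fun i => c u (κ i)) ∈ Att t a := by
  by_contra h
  simp only [Att, Set.mem_ofPred_eq, not_or, not_forall, not_not] at h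
  obtain ⟨⟨k, hk⟩, ⟨i, hi⟩, ⟨j, hj⟩⟩ := h
  rcases k with k | k
  · have := hc.2.2 _ _ _ _ _ hk (hκ k j) hj
    simp at this
  · have h2 := hκ i k
    rw [hc.1] at h2
    have := hc.2.2 _ _ _ _ _ hk h2 hi
    simp at this

lemma card_att (t : ℕ) (a : Bool) (Z : Finset (Fin t ⊕ Fin t)) :
    {s | s ∈ Att t a ∧ ∀ i ∈ Z, s i = none}.ncard ≤ 2 ^ (2 * t - Z.card) + 2 * 3 ^ t := by
  classical
  have h1 : {s : Fin t ⊕ Fin t → Option Bool | ∀ i, s i ≠ some (!a) ∧ (i ∈ Z → s i = none)}.ncard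
      ≤ 2 ^ (2 * t - Z.card) := by
    have : {s : Fin t ⊕ Fin t → Option Bool | ∀ i, s i ≠ some (!a) ∧ (i ∈ Z → s i = none)} ⊆
      ((Fintype.piFinset fun i : Fin t ⊕ Fin t =>
        if i ∈ Z then ({none} : Finset (Option Bool)) else {none, some a} : Finset _) :
          Set (Fin t ⊕ Fin t → Option Bool)) := by
      intro s hs
      simp only [Finset.mem_coe, Fintype.mem_piFinset]
      intro i
      obtain ⟨h1, h2⟩ := hs i
      split_ifs with h
      · simp [h2 h]
      · rcases hx : s i with _ | b
        · simp
        · rw [hx] at h1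
          cases a <;> cases b <;> simp_all
    refine (Set.ncard_le_ncard this (Set.toFinite _)).trans ?_
    rw [Set.ncard_coe_finset, Fintype.card_piFinset]
    have : ∀ i : Fin t ⊕ Fin t, (if i ∈ Z then ({none} : Finset (Option Bool)) else {none, some a}).card
        = if i ∈ Z then 1 else 2 := by
      intro i; split_ifs <;> simp
    simp_rw [this]
    rw [Finset.prod_ite]
    simp only [Finset.prod_const, one_pow, one_mul]
    apply Nat.pow_le_pow_right (by norm_num)
    rw [Finset.filter_not, Finset.card_sdiff]
    simp
    omega
  have h2 : {s : Fin t ⊕ Fin t → Option Bool | ∀ i, s (Sum.inl i) = none}.ncard ≤ 3 ^ t := by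
    have : (Set.univ : Set (Fin t → Option Bool)).ncard = 3 ^ t := by
      rw [Set.ncard_univ, Nat.card_eq_fintype_card]; simp
    rw [← this]
    apply Set.ncard_le_ncard_of_injOn (fun s j => s (Sum.inr j))
    · intros; trivial
    · intro s hs s' hs' h
      funext i
      rcases i with i | i
      · rw [hs, hs']
      · exact congrFun h i
  have h3 : {s : Fin t ⊕ Fin t → Option Bool | ∀ i, s (Sum.inr i) = none}.ncard ≤ 3 ^ t := by
    have : (Set.univ : Set (Fin t → Option Bool)).ncard = 3 ^ t := by
      rw [Set.ncard_univ, Nat.card_eq_fintype_card]; simp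
    rw [← this]
    apply Set.ncard_le_ncard_of_injOn (fun s j => s (Sum.inl j))
    · intros; trivial
    · intro s hs s' hs' h
      funext i
      rcases i with i | i
      · exact congrFun h i
      · rw [hs, hs']
  have hsub : {s | s ∈ Att t a ∧ ∀ i ∈ Z, s i = none} ⊆
      {s : Fin t ⊕ Fin t → Option Bool | ∀ i, s i ≠ some (!a) ∧ (i ∈ Z → s i = none)} ∪
      ({s : Fin t ⊕ Fin t → Option Bool | ∀ i, s (Sum.inl i) = none} ∪
       {s : Fin t ⊕ Fin t → Option Bool | ∀ i, s (Sum.inr i) = none}) := by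
    rintro s ⟨h | h | h, h'⟩
    · exact Or.inl fun i => ⟨h i, h' i⟩
    · exact Or.inr (Or.inl h)
    · exact Or.inr (Or.inr h)
  have := Set.ncard_le_ncard hsub (Set.toFinite _)
  have h4 := Set.ncard_union_le {s : Fin t ⊕ Fin t → Option Bool | ∀ i, s i ≠ some (!a) ∧ (i ∈ Z → s i = none)}
      ({s : Fin t ⊕ Fin t → Option Bool | ∀ i, s (Sum.inl i) = none} ∪
       {s : Fin t ⊕ Fin t → Option Bool | ∀ i, s (Sum.inr i) = none})
  have h5 := Set.ncard_union_le {s : Fin t ⊕ Fin t → Option Bool | ∀ i, s (Sum.inl i) = none}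
       {s : Fin t ⊕ Fin t → Option Bool | ∀ i, s (Sum.inr i) = none}
  omega

lemma exists_t (δ : ℝ) (hδ : 0 < δ) : ∃ t : ℕ, 1 ≤ t ∧ ∀ p : ℕ, p ≤ 2 * t →
    ((2 : ℝ) ^ (2 * t - p) + 2 * 3 ^ t) ≤ (2 : ℝ) ^ (2 * (t : ℝ) + 2 * δ - (p : ℝ) / 10) := by
  have hlim : Filter.Tendsto (fun t : ℕ => ((30:ℝ)/34) ^ t) Filter.atTop (nhds 0) :=
    tendsto_pow_atTop_nhds_zero_of_lt_one (by norm_num) (by norm_num)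
  have hev := (hlim.eventually (gt_mem_nhds (show (0:ℝ) < δ / 2 by positivity))).and
    (Filter.eventually_ge_atTop 1)
  obtain ⟨t, ht, ht1⟩ := hev.exists
  refine ⟨t, ht1, ?_⟩
  intro p hp
  have e1 : (1 + δ) ≤ (2:ℝ) ^ (2 * δ) := by
    rw [Real.rpow_def_of_pos (by norm_num)]
    have h1 := Real.add_one_le_exp (Real.log 2 * (2 * δ))
    have h2 := Real.log_two_gt_d9
    nlinarith
  have e2 : (2:ℝ) ^ (2 * t - p) ≤ (2:ℝ) ^ (2 * (t:ℝ) - (p:ℝ)/10) := by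
    rw [← Real.rpow_natCast, Nat.cast_sub hp]
    apply Real.rpow_le_rpow_of_exponent_le (by norm_num)
    push_cast
    have : (0:ℝ) ≤ p := by positivity
    linarith
  have e3 : (3.4:ℝ) ^ t ≤ (2:ℝ) ^ (2 * (t:ℝ) - (p:ℝ)/10) := by
    calc (3.4:ℝ) ^ t ≤ ((2:ℝ) ^ ((9:ℝ)/5)) ^ t := by
          gcongr
          rw [← pow_le_pow_iff_left₀ (n := 5) (by norm_num) (by positivity) (by norm_num),
            ← Real.rpow_natCast ((2:ℝ)^((9:ℝ)/5)), ← Real.rpow_mul (by norm_num)]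
          norm_num
      _ = (2:ℝ) ^ ((9:ℝ)/5 * t) := by
          rw [← Real.rpow_natCast, ← Real.rpow_mul (by norm_num)]
      _ ≤ _ := by
          apply Real.rpow_le_rpow_of_exponent_le (by norm_num)
          have : (p:ℝ) ≤ 2 * t := by exact_mod_cast hp
          linarith
  have e4 : (2:ℝ) * 3 ^ t ≤ δ * (3.4:ℝ) ^ t := by
    have : (3:ℝ) ^ t = ((30:ℝ)/34) ^ t * 3.4 ^ t := by
      rw [← mul_pow]; norm_num
    rw [this]
    have h34 : (0:ℝ) < 3.4 ^ t := by positivity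
    nlinarith
  have e5 : (2 : ℝ) ^ (2 * (t : ℝ) + 2 * δ - (p : ℝ) / 10) =
      2 ^ (2 * δ) * (2:ℝ) ^ (2 * (t:ℝ) - (p:ℝ)/10) := by
    rw [← Real.rpow_add (by norm_num)]; congr 1; ring
  rw [e5]
  set W := (2:ℝ) ^ (2 * (t:ℝ) - (p:ℝ)/10)
  have : 0 < W := by positivity
  nlinarith

lemma count_sparse {V : Type} [Fintype V] :
    ({c : V → V → Option Bool | 100 * {p : V × V | c p.1 p.2 ≠ none}.ncard ≤ Fintype.card V ^ 2}.ncard : ℝ)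
      ≤ (2:ℝ) ^ ((Fintype.card V : ℝ) ^ 2 / 4) := by
  classical
  set n := Fintype.card V with hn
  set k := n ^ 2 / 100 with hk
  have h1 := count_few_bad (ι := V × V) (σ := Option Bool) (fun x => x ≠ none) (1/32)
    (by norm_num) (by norm_num) k
  have h2 : {c : V → V → Option Bool | 100 * {p : V × V | c p.1 p.2 ≠ none}.ncard ≤ n ^ 2}.ncard ≤
      {s : V × V → Option Bool | (univ.filter fun i => s i ≠ none).card ≤ k}.ncard := by
    apply Set.ncard_le_ncard_of_injOn (fun c p => c p.1 p.2)
    · intro c hc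
      simp only [Set.mem_ofPred_eq] at hc ⊢
      rw [Set.ncard_eq_toFinset_card'] at hc
      simp only [Set.toFinset_ofPred] at hc
      omega
    · intro c _ d _ h
      funext x y
      exact congrFun h (x, y)
  have h3 : (∑ x : Option Bool, if x ≠ none then (1/32:ℝ) else 1) = 17/16 := by
    simp [Fintype.sum_option]; norm_num
  rw [h3, Fintype.card_prod, ← hn] at h1
  have h4 : ((1:ℝ)/32)^k = ((32:ℝ)^k)⁻¹ := by rw [one_div, inv_pow]
  rw [h4, ← div_eq_mul_inv, div_le_iff₀ (by positivity)] at h1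
  have h5 : (32:ℝ)^k ≤ (2:ℝ) ^ ((n:ℝ)^2 / 20) := by
    rw [show (32:ℝ) = 2 ^ (5:ℕ) by norm_num, ← pow_mul, ← Real.rpow_natCast]
    apply Real.rpow_le_rpow_of_exponent_le (by norm_num)
    have : (100:ℝ) * k ≤ (n:ℝ)^2 := by
      have : 100 * k ≤ n ^ 2 := by omega
      exact_mod_cast this
    push_cast; linarith
  have h6 : ((17:ℝ)/16)^(n*n) ≤ (2:ℝ) ^ ((n:ℝ)^2 / 8) := by
    calc ((17:ℝ)/16)^(n*n) ≤ ((2:ℝ) ^ ((1:ℝ)/8)) ^ (n*n) := by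
          gcongr
          rw [← pow_le_pow_iff_left₀ (n := 8) (by norm_num) (by positivity) (by norm_num),
            ← Real.rpow_natCast ((2:ℝ)^((1:ℝ)/8)), ← Real.rpow_mul (by norm_num)]
          norm_num
      _ = _ := by
          rw [← Real.rpow_natCast, ← Real.rpow_mul (by norm_num)]
          congr 1; push_cast; ring
  calc _ ≤ ({s : V × V → Option Bool | (univ.filter fun i => s i ≠ none).card ≤ k}.ncard : ℝ) := by
        exact_mod_cast h2
    _ ≤ _ := h1
    _ ≤ (2:ℝ) ^ ((n:ℝ)^2 / 8) * (2:ℝ) ^ ((n:ℝ)^2 / 20) := by gcongr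
    _ ≤ _ := by
      rw [← Real.rpow_add (by norm_num)]
      apply Real.rpow_le_rpow_of_exponent_le (by norm_num)
      have : 0 ≤ (n:ℝ)^2 := by positivity
      linarith

end FNT

namespace FNT

open Finset

def Hole {V : Type} (X Y : Finset V) (c : V → V → Option Bool) : Prop :=
  ∀ x ∈ X, ∀ y ∈ Y, c x y = none

lemma coarse_arith (δ t n x y p q : ℝ) (hδ : 0 < δ) (ht : 1 ≤ t) (hn : 0 ≤ n)
    (hpq : p * q ≤ (2 * t) * (2 * t)) :
    (1/2 + δ) * (n - 2 * t) ^ 2 - x * y / 10 + ((2 * t + 2 * δ) * (n - 2 * t) - (p * y + q * x) / 10)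
      ≤ (1/2 + δ) * n ^ 2 - (x + p) * (y + q) / 10 - 2 * δ * n + 4 * δ * t ^ 2 := by
  have h1 : δ * n ≤ δ * n * t := le_mul_of_one_le_right (by positivity) ht
  have h2 : 0 ≤ δ * t := by positivity
  nlinarith

lemma coarse_sum {W : Type} [Fintype W] [DecidableEq W] (X' Y' : Finset W) (hXY' : Disjoint X' Y')
    (A p q : ℝ) (z : W → ℝ) (hY : ∀ u ∈ Y', z u = p) (hX : ∀ u ∈ X', z u = q)
    (h0 : ∀ u, u ∉ Y' → u ∉ X' → z u = 0) :
    ∑ u, (A - z u / 10) = A * Fintype.card W - (p * Y'.card + q * X'.card) / 10 := by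
  have h1 : ∀ u, A - z u / 10 = A -
      ((if u ∈ Y' then p else 0) + (if u ∈ X' then q else 0)) / 10 := by
    intro u
    by_cases h1 : u ∈ Y'
    · have h2 : u ∉ X' := fun h => Finset.disjoint_left.1 hXY' h h1
      rw [if_pos h1, if_neg h2, hY u h1, add_zero]
    · by_cases h2 : u ∈ X'
      · rw [if_neg h1, if_pos h2, hX u h2, zero_add]
      · rw [if_neg h1, if_neg h2, h0 u h1 h2, zero_add]
  simp_rw [h1]
  rw [Finset.sum_sub_distrib, ← Finset.sum_div, Finset.sum_add_distrib, Finset.sum_ite_mem,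
    Finset.sum_ite_mem, Finset.univ_inter, Finset.univ_inter, Finset.sum_const, Finset.sum_const,
    Finset.sum_const, Finset.card_univ, nsmul_eq_mul, nsmul_eq_mul, nsmul_eq_mul]
  ring

lemma coarse_prod {W ι : Type} [Fintype W] [DecidableEq W] [Fintype ι]
    (F : W → Finset (ι → Option Bool)) (e : W → ℝ)
    (hF : ∀ u, ((F u).card : ℝ) ≤ (2:ℝ) ^ (e u)) :
    (((Fintype.piFinset F : Finset (W → ι → Option Bool)) : Set (W → ι → Option Bool)).ncard : ℝ)
      ≤ (2:ℝ) ^ (∑ u, e u) := by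
  rw [Set.ncard_coe_finset, Fintype.card_piFinset, Real.rpow_sum_of_pos (by norm_num)]
  push_cast
  exact Finset.prod_le_prod (fun _ _ => by positivity) (fun u _ => hF u)

lemma coarse_att (t : ℕ) (a : Bool) {W : Type} [Fintype W] [DecidableEq W]
    (Z : W → Finset (Fin t ⊕ Fin t)) (e : W → ℝ)
    (he : ∀ u, (2 : ℝ) ^ (2 * t - (Z u).card) + 2 * 3 ^ t ≤ (2:ℝ) ^ (e u)) :
    (({f : W → Fin t ⊕ Fin t → Option Bool | ∀ u, f u ∈ Att t a ∧ ∀ i ∈ Z u, f u i = none}).ncard : ℝ)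
      ≤ (2:ℝ) ^ (∑ u, e u) := by
  classical
  have hs : {f : W → Fin t ⊕ Fin t → Option Bool | ∀ u, f u ∈ Att t a ∧ ∀ i ∈ Z u, f u i = none} =
      ((Fintype.piFinset fun u => {s | s ∈ Att t a ∧ ∀ i ∈ Z u, s i = none}.toFinset :
        Finset (W → Fin t ⊕ Fin t → Option Bool)) : Set (W → Fin t ⊕ Fin t → Option Bool)) := by
    ext f
    simp only [Finset.mem_coe, Fintype.mem_piFinset, Set.mem_toFinset, Set.mem_ofPred_eq]
  rw [hs]
  apply coarse_prod
  intro u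
  have h1 := card_att t a (Z u)
  rw [Set.ncard_eq_toFinset_card'] at h1
  refine le_trans ?_ (he u)
  exact_mod_cast h1

lemma coarse_step (δ : ℝ) (hδ : 0 < δ) (t : ℕ) (ht1 : 1 ≤ t)
    (ht : ∀ p : ℕ, p ≤ 2 * t →
      ((2 : ℝ) ^ (2 * t - p) + 2 * 3 ^ t) ≤ (2 : ℝ) ^ (2 * (t : ℝ) + 2 * δ - (p : ℝ) / 10))
    (C : ℝ) (hC : 0 ≤ C) {V : Type} [Fintype V] (X Y : Finset V) (hXY : Disjoint X Y)
    (IH : ∀ (W : Type) [Fintype W] (X' Y' : Finset W), Fintype.card W < Fintype.card V →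
      Disjoint X' Y' →
      ({c : W → W → Option Bool | Valid c ∧ Hole X' Y' c}.ncard : ℝ) ≤
        C * (2:ℝ) ^ ((1/2 + δ) * (Fintype.card W : ℝ) ^ 2 - (X'.card * Y'.card : ℝ) / 10))
    (a : Bool) (κ : Fin t ⊕ Fin t → V) (hκ : Function.Injective κ) :
    ({c : V → V → Option Bool | (Valid c ∧ Hole X Y c) ∧
        ∀ i j, c (κ (Sum.inl i)) (κ (Sum.inr j)) = some a}.ncard : ℝ) ≤
      3 ^ ((2 * t) ^ 2) * (C * (2:ℝ) ^ ((1/2 + δ) * (Fintype.card V : ℝ) ^ 2 -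
        (X.card * Y.card : ℝ) / 10 - 2 * δ * Fintype.card V + 4 * δ * t ^ 2)) := by
  classical
  obtain ⟨X', hX'⟩ : ∃ X' : Finset {u : V // u ∉ Set.range κ}, X' = univ.filter fun u => u.1 ∈ X :=
    ⟨_, rfl⟩
  obtain ⟨Y', hY'⟩ : ∃ X' : Finset {u : V // u ∉ Set.range κ}, X' = univ.filter fun u => u.1 ∈ Y :=
    ⟨_, rfl⟩
  obtain ⟨ZX, hZX⟩ : ∃ Z : Finset (Fin t ⊕ Fin t), Z = univ.filter fun i => κ i ∈ X := ⟨_, rfl⟩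
  obtain ⟨ZY, hZY⟩ : ∃ Z : Finset (Fin t ⊕ Fin t), Z = univ.filter fun i => κ i ∈ Y := ⟨_, rfl⟩
  have cX : X'.card + ZX.card = X.card := by rw [hX', hZX]; exact card_restrict κ hκ X
  have cY : Y'.card + ZY.card = Y.card := by rw [hY', hZY]; exact card_restrict κ hκ Y
  have cι : Fintype.card (Fin t ⊕ Fin t) = 2 * t := by simp; ring
  have cV : Fintype.card {u : V // u ∉ Set.range κ} + 2 * t = Fintype.card V := by
    have := card_compl_range κ hκ
    rw [cι] at this
    exact this
  have hp : ZX.card ≤ 2 * t := cι ▸ Finset.card_le_univ ZX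
  have hq : ZY.card ≤ 2 * t := cι ▸ Finset.card_le_univ ZY
  have mX : ∀ u, u ∈ X' ↔ u.1 ∈ X := by intro u; simp [hX']
  have mY : ∀ u, u ∈ Y' ↔ u.1 ∈ Y := by intro u; simp [hY']
  have mZX : ∀ u, u ∈ ZX ↔ κ u ∈ X := by intro u; simp [hZX]
  have mZY : ∀ u, u ∈ ZY ↔ κ u ∈ Y := by intro u; simp [hZY]
  clear hX' hY' hZX hZY
  have hXY' : Disjoint X' Y' := by
    rw [Finset.disjoint_left] at hXY ⊢
    intro u hu hu'
    exact hXY ((mX u).1 hu) ((mY u).1 hu')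
  have ih := IH _ X' Y' (by omega) hXY'
  obtain ⟨Z, hZ1, hZ2, hZ3⟩ : ∃ Z : {u : V // u ∉ Set.range κ} → Finset (Fin t ⊕ Fin t),
      (∀ u ∈ Y', Z u = ZX) ∧ (∀ u ∈ X', Z u = ZY) ∧ (∀ u, u ∉ Y' → u ∉ X' → Z u = ∅) := by
    refine ⟨fun u => if u ∈ Y' then ZX else if u ∈ X' then ZY else ∅, ?_, ?_, ?_⟩
    · intro u hu; exact if_pos hu
    · intro u hu
      have : u ∉ Y' := Finset.disjoint_left.1 hXY' hu
      show (if u ∈ Y' then ZX else if u ∈ X' then ZY else ∅) = ZY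
      rw [if_neg this, if_pos hu]
    · intro u h1 h2
      show (if u ∈ Y' then ZX else if u ∈ X' then ZY else ∅) = ∅
      rw [if_neg h1, if_neg h2]
  have hatt := coarse_att t a Z (fun u => (2 * (t:ℝ) + 2 * δ) - ((Z u).card : ℝ) / 10) (by
    intro u
    apply ht
    rw [← cι]
    exact Finset.card_le_univ _)
  rw [coarse_sum X' Y' hXY' (2 * (t:ℝ) + 2 * δ) ZX.card ZY.card (fun u => ((Z u).card : ℝ))
    (fun u hu => by simp only [hZ1 u hu]) (fun u hu => by simp only [hZ2 u hu])
    (fun u h1 h2 => by simp only [hZ3 u h1 h2, Finset.card_empty, Nat.cast_zero])] at hatt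
  have hrem := removal κ
    {c : V → V → Option Bool | (Valid c ∧ Hole X Y c) ∧
        ∀ i j, c (κ (Sum.inl i)) (κ (Sum.inr j)) = some a}
    (fun c hc => hc.1.1)
    {c | Valid c ∧ Hole X' Y' c}
    {f | ∀ u, f u ∈ Att t a ∧ ∀ i ∈ Z u, f u i = none}
    (by
      intro c hc
      refine ⟨hc.1.1.restrict _, ?_⟩
      intro x hx y hy
      exact hc.1.2 _ ((mX x).1 hx) _ ((mY y).1 hy))
    (by
      intro c hc u
      refine ⟨mem_att hc.1.1 t a κ hc.2 u, ?_⟩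
      intro i hi
      by_cases h1 : u ∈ Y'
      · rw [hZ1 u h1] at hi
        exact (hc.1.1.1 _ _).trans (hc.1.2 _ ((mZX i).1 hi) _ ((mY u).1 h1))
      · by_cases h2 : u ∈ X'
        · rw [hZ2 u h2] at hi
          exact hc.1.2 _ ((mX u).1 h2) _ ((mZY i).1 hi)
        · rw [hZ3 u h1 h2] at hi
          simp at hi)
  rw [cι] at hrem
  have hcast := (Nat.cast_le (α := ℝ)).2 hrem
  push_cast at hcast
  refine hcast.trans ?_
  rw [mul_comm]
  refine mul_le_mul_of_nonneg_left ?_ (by positivity)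
  refine (mul_le_mul ih hatt (Nat.cast_nonneg _) (by positivity)).trans ?_
  rw [mul_assoc, ← Real.rpow_add (by norm_num)]
  refine mul_le_mul_of_nonneg_left (Real.rpow_le_rpow_of_exponent_le (by norm_num) ?_) hC
  have c1 : (Fintype.card {u : V // u ∉ Set.range κ} : ℝ) = Fintype.card V - 2 * t := by
    rw [← cV]; push_cast; ring
  have c2 : (X.card : ℝ) = X'.card + ZX.card := by rw [← cX]; push_cast; ring
  have c3 : (Y.card : ℝ) = Y'.card + ZY.card := by rw [← cY]; push_cast; ring
  rw [c2, c3, c1]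
  have b1 : (ZX.card : ℝ) ≤ 2 * t := by exact_mod_cast hp
  have b2 : (ZY.card : ℝ) ≤ 2 * t := by exact_mod_cast hq
  have b3 : (0:ℝ) ≤ ZX.card := by positivity
  have b4 : (0:ℝ) ≤ ZY.card := by positivity
  have b5 : (ZX.card : ℝ) * ZY.card ≤ (2 * t) * (2 * t) := by gcongr
  exact coarse_arith _ _ _ _ _ _ _ hδ (by exact_mod_cast ht1) (by positivity) b5

lemma coarse (δ : ℝ) (hδ : 0 < δ) : ∃ C : ℝ, 1 ≤ C ∧
    ∀ (n : ℕ) (V : Type) [Fintype V] (X Y : Finset V), Fintype.card V = n → Disjoint X Y →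
      ({c : V → V → Option Bool | Valid c ∧ Hole X Y c}.ncard : ℝ) ≤
        C * (2:ℝ) ^ ((1/2 + δ) * (Fintype.card V : ℝ) ^ 2 - (X.card * Y.card : ℝ) / 10) := by
  classical
  obtain ⟨t, ht1, ht⟩ := exists_t δ hδ
  obtain ⟨N1, hN1⟩ := kst t
  have hev : ∀ᶠ n : ℕ in Filter.atTop,
      (n:ℝ) ^ (2 * t) * (4 * 3 ^ ((2 * t) ^ 2) * (2:ℝ) ^ (4 * δ * t ^ 2)) ≤ (2:ℝ) ^ (2 * δ * n) := by
    have h1 : (1:ℝ) < (2:ℝ) ^ (2 * δ) := Real.one_lt_rpow (by norm_num) (by positivity)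
    have h2 := isLittleO_pow_const_const_pow_of_one_lt (R := ℝ) (2 * t) h1
    set D : ℝ := (4 * 3 ^ ((2 * t) ^ 2) * (2:ℝ) ^ (4 * δ * t ^ 2)) with hD
    have hDpos : 0 < D := by positivity
    have h3 := h2.def (c := D⁻¹) (by positivity)
    filter_upwards [h3] with n hn
    rw [Real.norm_of_nonneg (by positivity), Real.norm_of_nonneg (by positivity)] at hn
    rw [Real.rpow_mul (by norm_num), Real.rpow_natCast]
    calc _ ≤ (D⁻¹ * ((2:ℝ) ^ (2 * δ)) ^ n) * D := by gcongr
      _ = _ := by field_simp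
  obtain ⟨N2, hN2⟩ := Filter.eventually_atTop.1 hev
  set N := N1 + N2 + 3 with hN
  refine ⟨3 ^ (N ^ 2), one_le_pow₀ (by norm_num), ?_⟩
  intro n
  induction n using Nat.strong_induction_on with
  | _ n ih =>
  intro V _ X Y hn hXY
  have hxy : ((X.card : ℝ) * Y.card) ≤ (Fintype.card V : ℝ) ^ 2 := by
    rw [sq]
    gcongr <;> exact Finset.card_le_univ _
  by_cases hlt : n < N
  · have h1 : {c : V → V → Option Bool | Valid c ∧ Hole X Y c}.ncard ≤ 3 ^ (N ^ 2) := by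
      refine (Set.ncard_le_ncard (Set.subset_univ _) (Set.toFinite _)).trans ?_
      rw [Set.ncard_univ, Nat.card_eq_fintype_card]
      simp only [Fintype.card_fun, Fintype.card_option, Fintype.card_bool, hn]
      rw [← pow_mul]
      apply Nat.pow_le_pow_right (by norm_num)
      nlinarith
    have h2 : (1:ℝ) ≤ (2:ℝ) ^ ((1/2 + δ) * (Fintype.card V : ℝ) ^ 2 - (X.card * Y.card : ℝ) / 10) := by
      apply Real.one_le_rpow (by norm_num)
      nlinarith [mul_nonneg hδ.le (sq_nonneg (Fintype.card V : ℝ)), sq_nonneg (Fintype.card V : ℝ)]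
    calc _ ≤ ((3 ^ (N ^ 2) : ℕ) : ℝ) := by exact_mod_cast h1
      _ = 3 ^ (N ^ 2) * 1 := by push_cast; ring
      _ ≤ _ := by gcongr
  push Not at hlt
  set C : ℝ := 3 ^ (N ^ 2) with hCdef
  have hC1 : 1 ≤ C := one_le_pow₀ (by norm_num)
  set E : ℝ := (1/2 + δ) * (Fintype.card V : ℝ) ^ 2 - (X.card * Y.card : ℝ) / 10 with hE
  set S : Set (V → V → Option Bool) := {c | Valid c ∧ Hole X Y c} with hS
  set Sp : Set (V → V → Option Bool) :=
    {c | 100 * {p : V × V | c p.1 p.2 ≠ none}.ncard ≤ Fintype.card V ^ 2} with hSp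
  set I : Finset ((Fin t ⊕ Fin t → V) × Bool) := univ.filter fun q => Function.Injective q.1 with hI
  let K : (Fin t ⊕ Fin t → V) × Bool → Set (V → V → Option Bool) := fun q =>
    {c | (Valid c ∧ Hole X Y c) ∧ ∀ i j, c (q.1 (Sum.inl i)) (q.1 (Sum.inr j)) = some q.2}
  have hcov : S ⊆ Sp ∪ ⋃ q ∈ I, K q := by
    intro c hc
    by_cases hsp : c ∈ Sp
    · exact Or.inl hsp
    right
    simp only [hSp, Set.mem_ofPred_eq, not_le] at hsp
    have hun : {p : V × V | c p.1 p.2 ≠ none} =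
        {p : V × V | c p.1 p.2 = some true} ∪ {p : V × V | c p.1 p.2 = some false} := by
      ext p
      simp only [Set.mem_ofPred_eq, Set.mem_union]
      rcases c p.1 p.2 with _ | _ | _ <;> simp
    have hle := Set.ncard_union_le {p : V × V | c p.1 p.2 = some true} {p : V × V | c p.1 p.2 = some false}
    rw [← hun] at hle
    have hex : ∃ a, Fintype.card V ^ 2 ≤ 200 * {p : V × V | c p.1 p.2 = some a}.ncard := by
      by_contra hno
      push Not at hno
      have h1 := hno true
      have h2 := hno false
      omega
    obtain ⟨a, ha⟩ := hex
    obtain ⟨κ, hκ, hκ2⟩ := hN1 V (by omega) (fun x y => c x y = some a)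
      (by intro x; simp [hc.1.2.1 x]) ha
    simp only [Set.mem_iUnion]
    exact ⟨(κ, a), by simpa [hI] using hκ, hc, hκ2⟩
  have hnV : (N : ℝ) ≤ Fintype.card V := by rw [hn]; exact_mod_cast hlt
  have hsparse : (Sp.ncard : ℝ) ≤ C * 2 ^ E / 2 := by
    refine count_sparse.trans ?_
    have : (2:ℝ) ^ ((Fintype.card V : ℝ) ^ 2 / 4) ≤ 2 ^ (E - 1) := by
      apply Real.rpow_le_rpow_of_exponent_le (by norm_num)
      have h3 : (3:ℝ) ≤ Fintype.card V := by
        refine le_trans ?_ hnV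
        exact_mod_cast (by omega : 3 ≤ N)
      nlinarith [mul_nonneg hδ.le (sq_nonneg (Fintype.card V : ℝ)), sq_nonneg (Fintype.card V : ℝ)]
    refine this.trans ?_
    rw [Real.rpow_sub (by norm_num), Real.rpow_one]
    have : (0:ℝ) < 2 ^ E := by positivity
    gcongr
    nlinarith
  have hK : ∀ q ∈ I, ((K q).ncard : ℝ) ≤ 3 ^ ((2 * t) ^ 2) * (C * (2:ℝ) ^ (E - 2 * δ * Fintype.card V + 4 * δ * t ^ 2)) := by
    intro q hq
    simp only [hI, Finset.mem_filter, Finset.mem_univ, true_and] at hq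
    refine coarse_step δ hδ t ht1 ht C (by linarith) X Y hXY ?_ q.2 q.1 hq
    intro W _ X' Y' hW hd
    exact ih (Fintype.card W) (by omega) W X' Y' rfl hd
  have hIc : (I.card : ℝ) ≤ (n:ℝ) ^ (2 * t) * 2 := by
    have : I.card ≤ n ^ (2 * t) * 2 := by
      refine (Finset.card_le_univ _).trans ?_
      simp [hn, two_mul]
    exact_mod_cast this
  have hKsum : ((∑ q ∈ I, (K q).ncard : ℕ) : ℝ) ≤ C * 2 ^ E / 2 := by
    push_cast
    calc _ ≤ ∑ q ∈ I, 3 ^ ((2 * t) ^ 2) * (C * (2:ℝ) ^ (E - 2 * δ * Fintype.card V + 4 * δ * t ^ 2)) :=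
          Finset.sum_le_sum hK
      _ = I.card * (3 ^ ((2 * t) ^ 2) * (C * (2:ℝ) ^ (E - 2 * δ * Fintype.card V + 4 * δ * t ^ 2))) := by
          simp
      _ ≤ ((n:ℝ) ^ (2 * t) * 2) * (3 ^ ((2 * t) ^ 2) * (C * (2:ℝ) ^ (E - 2 * δ * Fintype.card V + 4 * δ * t ^ 2))) := by
          gcongr
      _ = ((n:ℝ) ^ (2 * t) * (4 * 3 ^ ((2 * t) ^ 2) * (2:ℝ) ^ (4 * δ * t ^ 2))) *
            (C * 2 ^ E / 2) / 2 ^ (2 * δ * n) := by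
          rw [Real.rpow_add (by norm_num), Real.rpow_sub (by norm_num), hn]
          field_simp; ring
      _ ≤ (2:ℝ) ^ (2 * δ * n) * (C * 2 ^ E / 2) / 2 ^ (2 * δ * n) := by
          gcongr
          exact hN2 n (by omega)
      _ = _ := by field_simp
  have hfin : S.ncard ≤ Sp.ncard + ∑ q ∈ I, (K q).ncard := by
    refine (Set.ncard_le_ncard hcov (Set.toFinite _)).trans ?_
    refine (Set.ncard_union_le _ _).trans ?_
    gcongr
    exact Finset.set_ncard_biUnion_le _ _
  calc (S.ncard : ℝ) ≤ Sp.ncard + ((∑ q ∈ I, (K q).ncard : ℕ) : ℝ) := by exact_mod_cast hfin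
    _ ≤ C * 2 ^ E := by linarith

end FNT

namespace FNT

open Finset

/-- Both colours occur. -/
def NM {V : Type} (c : V → V → Option Bool) : Prop := ∀ a, ∃ x y, c x y = some a

/-- A big hole. -/
def CaseH {V : Type} [Fintype V] (c : V → V → Option Bool) : Prop :=
  ∃ X Y : Finset V, Disjoint X Y ∧ Fintype.card V ≤ 100 * X.card ∧ Fintype.card V ≤ 100 * Y.card ∧
    Hole X Y c

/-- A low degree vertex. -/
def CaseD {V : Type} [Fintype V] (v : V) (c : V → V → Option Bool) : Prop :=
  50 * (univ.filter fun u => c u v ≠ none).card ≤ Fintype.card V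

/-- A bad edge. -/
def CaseE {V : Type} [Fintype V] (v w : V) (a m m' : Bool) (c : V → V → Option Bool) : Prop :=
  v ≠ w ∧ c v w = some a ∧ ¬ (m = a ∧ m' = a) ∧
    100 * (univ.filter fun u => c u v = some !m).card ≤ Fintype.card V ∧
    100 * (univ.filter fun u => c u w = some !m').card ≤ Fintype.card V

lemma case_split {V : Type} [Fintype V] (c : V → V → Option Bool) (hc : Valid c) (hnm : NM c) :
    CaseH c ∨ (∃ v, CaseD v c) ∨ ∃ v w a m m', CaseE v w a m m' c := by
  classical
  by_contra hno
  simp only [not_or, not_exists] at hno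
  obtain ⟨hH, hD, hE⟩ := hno
  have hm : ∀ v, ∃ m : Bool, Fintype.card V ≤ 100 * (univ.filter fun u => c u v = some m).card ∧
      100 * (univ.filter fun u => c u v = some !m).card ≤ Fintype.card V := by
    intro v
    have h1 := hD v
    unfold CaseD at h1
    push Not at h1
    have h2 : (univ.filter fun u => c u v ≠ none).card ≤
        (univ.filter fun u => c u v = some true).card +
        (univ.filter fun u => c u v = some false).card := by
      refine le_trans (Finset.card_le_card ?_) (Finset.card_union_le _ _)
      intro u
      simp only [Finset.mem_filter, Finset.mem_univ, true_and, Finset.mem_union]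
      rcases c u v with _ | _ | _ <;> simp
    have h3 : ¬ (Fintype.card V ≤ 100 * (univ.filter fun u => c u v = some true).card ∧
        Fintype.card V ≤ 100 * (univ.filter fun u => c u v = some false).card) := by
      rintro ⟨ha, hb⟩
      apply hH
      refine ⟨_, _, ?_, ha, hb, ?_⟩
      · rw [Finset.disjoint_left]
        intro u hu hu'
        simp only [Finset.mem_filter, Finset.mem_univ, true_and] at hu hu'
        rw [hu] at hu'; simp at hu'
      · intro x hx y hy
        simp only [Finset.mem_filter, Finset.mem_univ, true_and] at hx hy
        by_contra hxy
        have := hc.2.2 x v y _ _ hx ((hc.1 _ _).trans hy) hxy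
        simp at this
    by_cases h4 : Fintype.card V ≤ 100 * (univ.filter fun u => c u v = some true).card
    · refine ⟨true, h4, ?_⟩
      simp only [Bool.not_true]
      by_contra h5
      exact h3 ⟨h4, by omega⟩
    · refine ⟨false, ?_, ?_⟩
      · omega
      · simp only [Bool.not_false]; omega
  choose m hm1 hm2 using hm
  have hedge : ∀ v w a, c v w = some a → m v = a ∧ m w = a := by
    intro v w a h
    by_contra hn
    refine hE v w a (m v) (m w) ⟨?_, h, hn, hm2 v, hm2 w⟩
    rintro rfl
    rw [hc.2.1] at h; simp at h
  have hbig : ∀ a, Fintype.card V ≤ 100 * (univ.filter fun u => m u = a).card := by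
    intro a
    obtain ⟨x, y, hxy⟩ := hnm a
    have h1 := (hedge x y a hxy).1
    refine (hm1 x).trans ?_
    gcongr
    intro hu
    rw [h1] at hu
    exact (hedge _ _ _ hu).1
  apply hH
  refine ⟨_, _, ?_, hbig true, hbig false, ?_⟩
  · rw [Finset.disjoint_left]
    intro u hu hu'
    simp only [Finset.mem_filter, Finset.mem_univ, true_and] at hu hu'
    rw [hu] at hu'; simp at hu'
  · intro x hx y hy
    simp only [Finset.mem_filter, Finset.mem_univ, true_and] at hx hy
    rcases h : c x y with _ | a
    · rfl
    · have := hedge x y a h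
      rw [hx, hy] at this
      have := this.1.trans this.2.symm
      simp at this

lemma count_H (δ C : ℝ) (hC : 0 ≤ C) {V : Type} [Fintype V]
    (h : ∀ X Y : Finset V, Disjoint X Y →
      ({c : V → V → Option Bool | Valid c ∧ Hole X Y c}.ncard : ℝ) ≤
        C * (2:ℝ) ^ ((1/2 + δ) * (Fintype.card V : ℝ) ^ 2 - (X.card * Y.card : ℝ) / 10)) :
    ({c : V → V → Option Bool | Valid c ∧ CaseH c}.ncard : ℝ) ≤
      4 ^ Fintype.card V * (C * (2:ℝ) ^ ((1/2 + δ) * (Fintype.card V : ℝ) ^ 2 -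
        (Fintype.card V : ℝ) ^ 2 / 100000)) := by
  classical
  obtain ⟨I, hI⟩ : ∃ I : Finset (Finset V × Finset V), I = univ.filter fun p =>
    Disjoint p.1 p.2 ∧ Fintype.card V ≤ 100 * p.1.card ∧ Fintype.card V ≤ 100 * p.2.card := ⟨_, rfl⟩
  have hcov : {c : V → V → Option Bool | Valid c ∧ CaseH c} ⊆
      ⋃ p ∈ I, {c : V → V → Option Bool | Valid c ∧ Hole p.1 p.2 c} := by
    rintro c ⟨hc, X, Y, hd, h1, h2, h3⟩
    simp only [Set.mem_iUnion]
    exact ⟨(X, Y), by simp [hI, hd, h1, h2], hc, h3⟩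
  have h1 := (Set.ncard_le_ncard hcov (Set.toFinite _)).trans (Finset.set_ncard_biUnion_le _ _)
  have h2 : ∀ p ∈ I, ({c : V → V → Option Bool | Valid c ∧ Hole p.1 p.2 c}.ncard : ℝ) ≤
      C * (2:ℝ) ^ ((1/2 + δ) * (Fintype.card V : ℝ) ^ 2 - (Fintype.card V : ℝ) ^ 2 / 100000) := by
    intro p hp
    simp only [hI, Finset.mem_filter, Finset.mem_univ, true_and] at hp
    refine (h p.1 p.2 hp.1).trans ?_
    refine mul_le_mul_of_nonneg_left (Real.rpow_le_rpow_of_exponent_le (by norm_num) ?_) hC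
    have a1 : (Fintype.card V : ℝ) ≤ 100 * p.1.card := by exact_mod_cast hp.2.1
    have a2 : (Fintype.card V : ℝ) ≤ 100 * p.2.card := by exact_mod_cast hp.2.2
    have := mul_le_mul a1 a2 (by positivity) (by positivity)
    nlinarith
  have h3 : (I.card : ℝ) ≤ 4 ^ Fintype.card V := by
    have : I.card ≤ 4 ^ Fintype.card V := by
      refine (Finset.card_le_univ _).trans ?_
      rw [Fintype.card_prod, Fintype.card_finset, ← mul_pow]
      norm_num
    exact_mod_cast this
  calc _ ≤ ((∑ p ∈ I, {c : V → V → Option Bool | Valid c ∧ Hole p.1 p.2 c}.ncard : ℕ) : ℝ) := by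
        exact_mod_cast h1
    _ ≤ ∑ p ∈ I, C * (2:ℝ) ^ ((1/2 + δ) * (Fintype.card V : ℝ) ^ 2 -
          (Fintype.card V : ℝ) ^ 2 / 100000) := by
        push_cast
        exact Finset.sum_le_sum h2
    _ = I.card * (C * (2:ℝ) ^ ((1/2 + δ) * (Fintype.card V : ℝ) ^ 2 -
          (Fintype.card V : ℝ) ^ 2 / 100000)) := by
        rw [Finset.sum_const, nsmul_eq_mul]
    _ ≤ _ := by
        refine mul_le_mul_of_nonneg_right h3 (by positivity)

lemma few_bad {ι σ : Type} [Fintype ι] [Fintype σ] (B : σ → Prop) [DecidablePred B]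
    (n : ℕ) (s : ℝ) (hs : (∑ x : σ, if B x then (1/100 : ℝ) else 1) ≤ s) (hs1 : 1 ≤ s)
    (hn : Fintype.card ι ≤ n) :
    ({f : ι → σ | (univ.filter fun i => B (f i)).card ≤ n / 50}.ncard : ℝ) ≤ (s * (11/10)) ^ n := by
  have h := count_few_bad (ι := ι) B (1/100) (by norm_num) (by norm_num) (n / 50)
  have h0 : 0 ≤ (∑ x : σ, if B x then (1/100 : ℝ) else 1) :=
    Finset.sum_nonneg (fun x _ => by split_ifs <;> norm_num)
  have h1 : (∑ x : σ, if B x then (1/100 : ℝ) else 1) ^ Fintype.card ι ≤ s ^ n :=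
    (pow_le_pow_left₀ h0 hs _).trans (pow_le_pow_right₀ hs1 hn)
  have h2 : (100:ℝ) ^ (n / 50) ≤ (11/10) ^ n := by
    calc (100:ℝ) ^ (n/50) ≤ ((11/10) ^ 50) ^ (n / 50) := by
          apply pow_le_pow_left₀ (by norm_num); norm_num
      _ = (11/10) ^ (50 * (n / 50)) := by rw [pow_mul]
      _ ≤ _ := pow_le_pow_right₀ (by norm_num) (by omega)
  rw [mul_pow]
  set A := ({f : ι → σ | (univ.filter fun i => B (f i)).card ≤ n / 50}.ncard : ℝ)
  have h3 : A = (A * (1/100) ^ (n / 50)) * 100 ^ (n/50) := by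
    rw [mul_assoc, ← mul_pow]; norm_num
  rw [h3]
  exact mul_le_mul (h.trans h1) h2 (by positivity) (by positivity)

lemma choose_two_succ (m : ℕ) : (m + 1).choose 2 = m.choose 2 + m := by
  rw [Nat.choose_succ_succ' m 1, Nat.choose_one_right, add_comm]

lemma count_D (M : ℝ) {V : Type} [Fintype V]
    (IH : ∀ (W : Type) [Fintype W], Fintype.card W < Fintype.card V →
      ({c : W → W → Option Bool | Valid c}.ncard : ℝ) ≤ M * 2 ^ (Fintype.card W).choose 2)
    (hM : 0 ≤ M) (v : V) :
    ({c : V → V → Option Bool | Valid c ∧ CaseD v c}.ncard : ℝ) ≤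
      M * 2 ^ (Fintype.card V - 1).choose 2 * (1122/1000) ^ Fintype.card V * 3 := by
  classical
  have hκ : Function.Injective (fun _ : Unit => v) := fun _ _ _ => rfl
  have hcard := card_compl_range (fun _ : Unit => v) hκ
  rw [Fintype.card_unit] at hcard
  have hrem := removal (fun _ : Unit => v) {c : V → V → Option Bool | Valid c ∧ CaseD v c}
    (fun c hc => hc.1) {c | Valid c}
    {f | (univ.filter fun i => (fun s : Unit → Option Bool => s () ≠ none) (f i)).card ≤
      Fintype.card V / 50}
    (fun c hc => hc.1.restrict _)
    (by
      intro c hc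
      simp only [Set.mem_ofPred_eq]
      have h1 : 50 * _ ≤ _ := hc.2
      rw [Nat.le_div_iff_mul_le (by norm_num), mul_comm]
      refine le_trans ?_ h1
      gcongr
      refine Finset.card_le_card_of_injOn (fun u => u.1) ?_ (fun x _ y _ h => Subtype.ext h)
      intro u hu
      simpa using hu)
  have hA := few_bad (ι := {u : V // u ∉ Set.range (fun _ : Unit => v)})
    (fun s : Unit → Option Bool => s () ≠ none) (Fintype.card V) (102/100)
    (by
      rw [Finset.sum_ite, Finset.sum_const, Finset.sum_const]
      have e1 : (univ.filter fun s : Unit → Option Bool => s () ≠ none).card = 2 := by decide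
      have e2 : (univ.filter fun s : Unit → Option Bool => ¬ (s () ≠ none)).card = 1 := by decide
      rw [e1, e2]; norm_num) (by norm_num) (by omega)
  have ih := IH {u : V // u ∉ Set.range (fun _ : Unit => v)} (by omega)
  have hW : Fintype.card {u : V // u ∉ Set.range (fun _ : Unit => v)} = Fintype.card V - 1 := by omega
  rw [hW] at ih
  have hcast := (Nat.cast_le (α := ℝ)).2 hrem
  push_cast at hcast
  refine hcast.trans ?_
  rw [Fintype.card_unit]
  have := mul_le_mul ih hA (Nat.cast_nonneg _) (by positivity)
  norm_num at this ⊢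
  exact this

/-- The bad attachments to an edge. -/
def BadE (m m' : Bool) (s : Bool → Option Bool) : Prop :=
  ¬ ((s false = none ∧ s true = none) ∨ (s false = some m ∧ s true = none) ∨
    (s false = none ∧ s true = some m'))

instance (m m' : Bool) : DecidablePred (BadE m m') := fun s => by unfold BadE; infer_instance

lemma badE_card (m m' : Bool) : (univ.filter fun s => BadE m m' s).card = 6 := by
  revert m m'; decide

lemma badE_card' (m m' : Bool) : (univ.filter fun s => ¬ BadE m m' s).card = 3 := by
  revert m m'; decide

lemma badE_cases {V : Type} {c : V → V → Option Bool} (hc : Valid c) {v w : V} {a m m' : Bool}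
    (ha : c v w = some a) (hm : ¬ (m = a ∧ m' = a)) (u : V)
    (hb : BadE m m' (fun i => c u (if i then w else v))) :
    c u v = some (!m) ∨ c u w = some (!m') := by
  by_contra hno
  have h1 : c u v = some m → c u w = some m' → False := by
    intro h1 h2
    have e1 : m = a := hc.2.2 _ _ _ _ _ h1 ha (by rw [h2]; simp)
    have e2 : m = m' := hc.2.2 v u w _ _ ((hc.1 _ _).trans h1) h2 (by rw [ha]; simp)
    exact hm ⟨e1, e2 ▸ e1⟩
  simp only [BadE, if_true, Bool.false_eq_true, if_false] at hb
  revert hb hno h1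
  generalize c u v = p
  generalize c u w = q
  clear ha hm
  revert p q m m'
  decide

lemma count_E (M : ℝ) {V : Type} [Fintype V]
    (IH : ∀ (W : Type) [Fintype W], Fintype.card W < Fintype.card V →
      ({c : W → W → Option Bool | Valid c}.ncard : ℝ) ≤ M * 2 ^ (Fintype.card W).choose 2)
    (hM : 0 ≤ M) (v w : V) (a m m' : Bool) :
    ({c : V → V → Option Bool | Valid c ∧ CaseE v w a m m' c}.ncard : ℝ) ≤
      M * 2 ^ (Fintype.card V - 2).choose 2 * (3366/1000) ^ Fintype.card V * 81 := by
  classical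
  by_cases hvw : v = w
  · have : {c : V → V → Option Bool | Valid c ∧ CaseE v w a m m' c} = ∅ := by
      ext c
      simp only [Set.mem_ofPred_eq, Set.mem_empty_iff_false, iff_false]
      rintro ⟨_, h, _⟩
      exact h hvw
    rw [this, Set.ncard_empty]
    push_cast
    positivity
  obtain ⟨κ, hκd⟩ : ∃ κ : Bool → V, κ = fun i => if i then w else v := ⟨_, rfl⟩
  have hκ : Function.Injective κ := by
    intro i j hij
    rw [hκd] at hij
    rcases i with _ | _ <;> rcases j with _ | _ <;> simp at hij ⊢
    · exact hvw hij
    · exact hvw hij.symm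
  have hcard := card_compl_range κ hκ
  rw [Fintype.card_bool] at hcard
  have hrem := removal κ {c : V → V → Option Bool | Valid c ∧ CaseE v w a m m' c}
    (fun c hc => hc.1) {c | Valid c}
    {f | (univ.filter fun i => BadE m m' (f i)).card ≤ Fintype.card V / 50}
    (fun c hc => hc.1.restrict _)
    (by
      intro c hc
      simp only [Set.mem_ofPred_eq]
      obtain ⟨-, h2, h3, h4, h5⟩ := hc.2
      rw [Nat.le_div_iff_mul_le (by norm_num), mul_comm]
      have h6 : (univ.filter fun u : {u : V // u ∉ Set.range κ} =>
            BadE m m' (fun i => c u.1 (κ i))).card ≤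
          ((univ.filter fun u => c u v = some !m) ∪ (univ.filter fun u => c u w = some !m')).card := by
        refine Finset.card_le_card_of_injOn (fun u => u.1) ?_ (fun x _ y _ h => Subtype.ext h)
        intro u hu
        simp only [hκd, Finset.coe_filter, Finset.mem_univ, true_and, Set.mem_ofPred_eq] at hu
        simpa using badE_cases hc.1 h2 h3 u.1 hu
      have h7 := h6.trans (Finset.card_union_le _ _)
      omega)
  have hA := few_bad (ι := {u : V // u ∉ Set.range κ})
    (BadE m m') (Fintype.card V) (306/100)
    (by
      rw [Finset.sum_ite, Finset.sum_const, Finset.sum_const, badE_card, badE_card']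
      norm_num) (by norm_num) (by omega)
  have ih := IH {u : V // u ∉ Set.range κ} (by omega)
  have hW : Fintype.card {u : V // u ∉ Set.range κ} = Fintype.card V - 2 := by omega
  rw [hW] at ih
  have hcast := (Nat.cast_le (α := ℝ)).2 hrem
  push_cast at hcast
  refine hcast.trans ?_
  rw [Fintype.card_bool]
  have := mul_le_mul ih hA (Nat.cast_nonneg _) (by positivity)
  norm_num at this ⊢
  exact this

end FNT

namespace FNT

open Finset

lemma H_arith (C : ℝ) : ∃ N : ℕ, ∀ n : ℕ, N ≤ n →
    (4:ℝ) ^ n * (C * (2:ℝ) ^ ((1/2 + 1/1000000) * (n : ℝ) ^ 2 - (n : ℝ) ^ 2 / 100000)) ≤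
      (9/10) ^ n * 2 ^ n.choose 2 / 4 := by
  obtain ⟨K, hK⟩ := pow_unbounded_of_one_lt C (show (1:ℝ) < 2 by norm_num)
  refine ⟨1000000 * (K + 1), ?_⟩
  intro n hn
  have hn' : (1000000 : ℝ) * (K + 1) ≤ n := by exact_mod_cast hn
  have h1 : C ≤ (2:ℝ) ^ (K:ℝ) := by rw [Real.rpow_natCast]; exact hK.le
  have h2 : (4:ℝ) ^ n = (2:ℝ) ^ (2 * (n:ℝ)) := by
    rw [Real.rpow_mul (by norm_num), Real.rpow_natCast]; norm_num
  have h3 : (2:ℝ) ^ (-(n:ℝ)) ≤ (9/10) ^ n := by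
    rw [Real.rpow_neg (by norm_num), Real.rpow_natCast, ← inv_pow]
    apply pow_le_pow_left₀ <;> norm_num
  have h4 : (2:ℝ) ^ n.choose 2 = (2:ℝ) ^ ((n:ℝ) * (n - 1) / 2) := by
    rw [← Real.rpow_natCast, Nat.cast_choose_two]
  have h5 : (2:ℝ) ^ (-(2:ℝ)) = 1 / 4 := by
    rw [Real.rpow_neg (by norm_num)]; norm_num
  calc _ ≤ (2:ℝ) ^ (2 * (n:ℝ)) * ((2:ℝ) ^ (K:ℝ) *
        (2:ℝ) ^ ((1/2 + 1/1000000) * (n : ℝ) ^ 2 - (n : ℝ) ^ 2 / 100000)) := by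
        rw [h2]; gcongr
    _ = (2:ℝ) ^ (2 * (n:ℝ) + (K + ((1/2 + 1/1000000) * (n : ℝ) ^ 2 - (n : ℝ) ^ 2 / 100000))) := by
        rw [← Real.rpow_add (by norm_num), ← Real.rpow_add (by norm_num)]
    _ ≤ (2:ℝ) ^ (-(n:ℝ) + (n:ℝ) * (n - 1) / 2 + -2) := by
        apply Real.rpow_le_rpow_of_exponent_le (by norm_num)
        have hK0 : (0:ℝ) ≤ K := by positivity
        nlinarith
    _ = (2:ℝ) ^ (-(n:ℝ)) * (2:ℝ) ^ ((n:ℝ) * (n - 1) / 2) * (1 / 4) := by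
        rw [Real.rpow_add (by norm_num), Real.rpow_add (by norm_num), h5]
    _ ≤ (9/10) ^ n * (2:ℝ) ^ ((n:ℝ) * (n - 1) / 2) * (1 / 4) := by gcongr
    _ = _ := by rw [h4]; ring

lemma poly_exp (k : ℕ) (D r s : ℝ) (hD : 0 < D) (hr : 0 < r) (hrs : r < s) :
    ∃ N : ℕ, ∀ n : ℕ, N ≤ n → D * (n:ℝ) ^ k * r ^ n ≤ s ^ n := by
  have h1 : 1 < s / r := by rwa [one_lt_div hr]
  have h2 := isLittleO_pow_const_const_pow_of_one_lt (R := ℝ) k h1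
  have h3 := h2.def (c := D⁻¹) (by positivity)
  obtain ⟨N, hN⟩ := Filter.eventually_atTop.1 h3
  refine ⟨N, fun n hn => ?_⟩
  have hs : 0 < s := hr.trans hrs
  have := hN n hn
  rw [Real.norm_of_nonneg (by positivity), Real.norm_of_nonneg (by positivity), div_pow] at this
  calc D * (n:ℝ) ^ k * r ^ n ≤ D * (D⁻¹ * (s ^ n / r ^ n)) * r ^ n := by gcongr
    _ = s ^ n := by field_simp

lemma main_step : ∃ N0 : ℕ, ∀ (V : Type) [Fintype V] (M : ℝ), N0 ≤ Fintype.card V → 1 ≤ M →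
    (∀ (W : Type) [Fintype W], Fintype.card W < Fintype.card V →
      ({c : W → W → Option Bool | Valid c}.ncard : ℝ) ≤ M * 2 ^ (Fintype.card W).choose 2) →
    ({c : V → V → Option Bool | Valid c ∧ NM c}.ncard : ℝ) ≤
      M * (9/10) ^ Fintype.card V * 2 ^ (Fintype.card V).choose 2 := by
  classical
  obtain ⟨C, hC1, hC⟩ := coarse (1/1000000) (by norm_num)
  obtain ⟨N1, hN1⟩ := H_arith C
  obtain ⟨N2, hN2⟩ := poly_exp 1 24 (1122/1000) (18/10) (by norm_num) (by norm_num) (by norm_num)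
  obtain ⟨N3, hN3⟩ := poly_exp 2 (8 * 81 * 32) (3366/1000) (36/10) (by norm_num) (by norm_num)
    (by norm_num)
  refine ⟨N1 + N2 + N3 + 2, ?_⟩
  intro V _ M hN hM IH
  have hH := count_H (1/1000000) C (by linarith) (V := V) (fun X Y h => hC _ V X Y rfl h)
  have hcov : {c : V → V → Option Bool | Valid c ∧ NM c} ⊆
      {c | Valid c ∧ CaseH c} ∪ ((⋃ v ∈ (univ : Finset V), {c | Valid c ∧ CaseD v c}) ∪
        ⋃ q ∈ (univ : Finset (V × V × Bool × Bool × Bool)),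
          {c | Valid c ∧ CaseE q.1 q.2.1 q.2.2.1 q.2.2.2.1 q.2.2.2.2 c}) := by
    rintro c ⟨hc, hnm⟩
    rcases case_split c hc hnm with h | ⟨v, h⟩ | ⟨v, w, a, m, m', h⟩
    · exact Or.inl ⟨hc, h⟩
    · refine Or.inr (Or.inl ?_)
      simp only [Set.mem_iUnion]
      exact ⟨v, Finset.mem_univ _, hc, h⟩
    · refine Or.inr (Or.inr ?_)
      simp only [Set.mem_iUnion]
      exact ⟨(v, w, a, m, m'), Finset.mem_univ _, hc, h⟩
  have h1 := (Set.ncard_le_ncard hcov (Set.toFinite _)).trans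
    ((Set.ncard_union_le _ _).trans (Nat.add_le_add_left ((Set.ncard_union_le _ _).trans
      (Nat.add_le_add (Finset.set_ncard_biUnion_le _ _) (Finset.set_ncard_biUnion_le _ _))) _))
  have h2 := (Nat.cast_le (α := ℝ)).2 h1
  push_cast at h2
  have hD := Finset.sum_le_sum (fun v (_ : v ∈ (univ : Finset V)) =>
    count_D M IH (by linarith) v)
  have hE := Finset.sum_le_sum (fun q (_ : q ∈ (univ : Finset (V × V × Bool × Bool × Bool))) =>
    count_E M IH (by linarith) q.1 q.2.1 q.2.2.1 q.2.2.2.1 q.2.2.2.2)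
  rw [Finset.sum_const, nsmul_eq_mul, Finset.card_univ] at hD hE
  have hcE : Fintype.card (V × V × Bool × Bool × Bool) = Fintype.card V ^ 2 * 8 := by
    simp only [Fintype.card_prod, Fintype.card_bool]; ring
  rw [hcE] at hE
  obtain ⟨n, hn⟩ : ∃ n, Fintype.card V = n + 2 := ⟨Fintype.card V - 2, by omega⟩
  rw [hn] at hH hD hE hN ⊢
  simp only [Nat.add_sub_cancel, show n + 2 - 1 = n + 1 by omega] at hD hE
  have a1 := hN1 (n + 2) (by omega)
  have a2 := hN2 (n + 2) (by omega)
  have a3 := hN3 (n + 2) (by omega)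
  have e1 : (2:ℝ) ^ (n+1).choose 2 = 2 ^ n.choose 2 * 2 ^ n := by
    rw [choose_two_succ, pow_add]
  have e2 : (2:ℝ) ^ (n+2).choose 2 = 2 ^ n.choose 2 * 2 ^ n * 2 ^ n * 2 := by
    rw [choose_two_succ (n+1), pow_add, e1, pow_succ]; ring
  set Q : ℝ := M * 2 ^ n.choose 2 with hQ
  have hQ0 : 0 ≤ Q := by positivity
  have b1 : (4:ℝ) ^ (n+2) * (C * (2:ℝ) ^ ((1/2 + 1/1000000) * ((n+2 : ℕ) : ℝ) ^ 2 - ((n+2 : ℕ) : ℝ) ^ 2 / 100000)) ≤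
      M * (9/10) ^ (n+2) * 2 ^ (n+2).choose 2 / 4 := by
    refine a1.trans ?_
    have : 0 ≤ (9/10 : ℝ) ^ (n+2) * 2 ^ (n+2).choose 2 / 4 := by positivity
    nlinarith
  have b2 : ((n+2 : ℕ) : ℝ) * (M * 2 ^ (n+1).choose 2 * (1122/1000) ^ (n+2) * 3) ≤
      M * (9/10) ^ (n+2) * 2 ^ (n+2).choose 2 / 4 := by
    have e3 : (18/10 : ℝ) ^ (n+2) = (9/10) ^ (n+2) * 2 ^ n * 4 := by
      rw [show (18/10 : ℝ) = 9/10 * 2 by norm_num, mul_pow, pow_add 2]; ring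
    have := mul_le_mul_of_nonneg_left a2 (show 0 ≤ Q * 2 ^ n / 8 by positivity)
    rw [e3] at this
    rw [e1, e2]
    calc _ = Q * 2 ^ n / 8 * (24 * ((n+2 : ℕ):ℝ) ^ 1 * (1122/1000) ^ (n+2)) := by rw [hQ]; ring
      _ ≤ _ := this
      _ = _ := by rw [hQ]; ring
  have b3 : ((((n+2) ^ 2 * 8 : ℕ)) : ℝ) * (M * 2 ^ n.choose 2 * (3366/1000) ^ (n+2) * 81) ≤
      M * (9/10) ^ (n+2) * 2 ^ (n+2).choose 2 / 4 := by
    have e3 : (36/10 : ℝ) ^ (n+2) = (9/10) ^ (n+2) * 2 ^ n * 2 ^ n * 16 := by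
      rw [show (36/10 : ℝ) = 9/10 * 2 * 2 by norm_num, mul_pow, mul_pow, pow_add 2]; ring
    have := mul_le_mul_of_nonneg_left a3 (show 0 ≤ Q / 32 by positivity)
    rw [e3] at this
    rw [e2]
    calc _ = Q / 32 * (8 * 81 * 32 * ((n+2 : ℕ):ℝ) ^ 2 * (3366/1000) ^ (n+2)) := by
          rw [hQ]; push_cast; ring
      _ ≤ _ := this
      _ = _ := by rw [hQ]; ring
  have b0 : 0 ≤ M * (9/10) ^ (n+2) * 2 ^ (n+2).choose 2 := by positivity
  linarith

lemma valid_cover {V : Type} [Fintype V] :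
    ({c : V → V → Option Bool | Valid c}.ncard : ℝ) ≤
      2 * 2 ^ (Fintype.card V).choose 2 + {c : V → V → Option Bool | Valid c ∧ NM c}.ncard := by
  have hcov : {c : V → V → Option Bool | Valid c} ⊆
      ({c | Valid c ∧ ∀ x y, c x y ≠ some true} ∪ {c | Valid c ∧ ∀ x y, c x y ≠ some false}) ∪
        {c | Valid c ∧ NM c} := by
    intro c hc
    by_cases h1 : ∀ x y, c x y ≠ some true
    · exact Or.inl (Or.inl ⟨hc, h1⟩)
    by_cases h2 : ∀ x y, c x y ≠ some false
    · exact Or.inl (Or.inr ⟨hc, h2⟩)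
    refine Or.inr ⟨hc, ?_⟩
    push Not at h1 h2
    rintro (_ | _)
    · exact h2
    · exact h1
  classical
  have h := (Set.ncard_le_ncard hcov (Set.toFinite _)).trans ((Set.ncard_union_le _ _).trans
    (Nat.add_le_add_right ((Set.ncard_union_le _ _).trans
      (Nat.add_le_add (count_mono true) (count_mono false))) _))
  rw [← two_mul] at h
  exact_mod_cast h

lemma main_count : ∃ (M : ℝ) (N0 : ℕ), 0 < M ∧ ∀ (V : Type) [Fintype V], N0 ≤ Fintype.card V →
    ({c : V → V → Option Bool | Valid c ∧ NM c}.ncard : ℝ) ≤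
      M * (9/10) ^ Fintype.card V * 2 ^ (Fintype.card V).choose 2 := by
  obtain ⟨N1, hN1⟩ := main_step
  set N0 := N1 + 7 with hN0
  set M : ℝ := 4 * 3 ^ (N0 ^ 2) with hM
  have hone : (1:ℝ) ≤ 3 ^ (N0 ^ 2) := one_le_pow₀ (by norm_num)
  have hM4 : 4 ≤ M := by rw [hM]; linarith
  have key : ∀ (n : ℕ) (V : Type) [Fintype V], Fintype.card V = n →
      ({c : V → V → Option Bool | Valid c}.ncard : ℝ) ≤ M * 2 ^ (Fintype.card V).choose 2 := by
    intro n
    induction n using Nat.strong_induction_on with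
    | _ n ih =>
    intro V _ hn
    by_cases hlt : n < N0
    · have h1 : {c : V → V → Option Bool | Valid c}.ncard ≤ 3 ^ (N0 ^ 2) := by
        classical
        refine (Set.ncard_le_ncard (Set.subset_univ _) (Set.toFinite _)).trans ?_
        rw [Set.ncard_univ, Nat.card_eq_fintype_card]
        simp only [Fintype.card_fun, Fintype.card_option, Fintype.card_bool, hn]
        rw [← pow_mul]
        apply Nat.pow_le_pow_right (by norm_num)
        nlinarith
      have h2 : (1:ℝ) ≤ 2 ^ (Fintype.card V).choose 2 := one_le_pow₀ (by norm_num)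
      calc _ ≤ ((3 ^ (N0 ^ 2) : ℕ) : ℝ) := by exact_mod_cast h1
        _ = 3 ^ (N0 ^ 2) * 1 := by push_cast; ring
        _ ≤ M * 2 ^ (Fintype.card V).choose 2 := by
          apply mul_le_mul _ h2 (by norm_num) (by linarith)
          rw [hM]; linarith
    · have h1 := hN1 V M (by omega) (by linarith) (fun W _ hW => ih _ (by omega) W rfl)
      refine valid_cover.trans ?_
      have h2 : (9/10 : ℝ) ^ Fintype.card V ≤ 1 / 2 := by
        calc (9/10 : ℝ) ^ Fintype.card V ≤ (9/10) ^ 7 :=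
              pow_le_pow_of_le_one (by norm_num) (by norm_num) (by omega)
          _ ≤ _ := by norm_num
      have h3 : M * (9/10) ^ Fintype.card V * 2 ^ (Fintype.card V).choose 2 ≤
          M * (1/2) * 2 ^ (Fintype.card V).choose 2 := by gcongr
      have h4 : (0:ℝ) ≤ 2 ^ (Fintype.card V).choose 2 := by positivity
      nlinarith
  refine ⟨M, N0, by linarith, ?_⟩
  intro V _ hV
  exact hN1 V M (by omega) (by linarith) (fun W _ _ => key _ W rfl)

end FNT

namespace FNT

open Finset

lemma rel_covers {α : Type} [Finite α] (r : α → α → Prop) (hr : IsPartialOrder α r) {u v : α}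
    (h : r u v) : Relation.ReflTransGen
      (fun u v => u ≠ v ∧ r u v ∧ ∀ z, r u z → r z v → z = u ∨ z = v) u v := by
  classical
  have key : ∀ (k : ℕ) (u v : α), {z | r u z ∧ r z v}.ncard = k → r u v → Relation.ReflTransGen
      (fun u v => u ≠ v ∧ r u v ∧ ∀ z, r u z → r z v → z = u ∨ z = v) u v := by
    intro k
    induction k using Nat.strong_induction_on with
    | _ k ih =>
    intro u v hk h
    by_cases huv : u = v
    · subst huv; exact Relation.ReflTransGen.refl
    by_cases hcov : ∀ z, r u z → r z v → z = u ∨ z = v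
    · exact Relation.ReflTransGen.single ⟨huv, h, hcov⟩
    push Not at hcov
    obtain ⟨z, h1, h2, h3, h4⟩ := hcov
    have hlt : ∀ a b, r u a → r b v → (¬ (r a u) ∨ ¬ (r v b)) → {z | r a z ∧ r z b}.ncard < k := by
      intro a b ha hb hab
      rw [← hk]
      apply Set.ncard_lt_ncard _ (Set.toFinite _)
      refine Set.ssubset_iff_subset_ne.2 ⟨fun w hw => ⟨hr.trans _ _ _ ha hw.1,
        hr.trans _ _ _ hw.2 hb⟩, ?_⟩
      intro heq
      have hu : u ∈ {z | r a z ∧ r z b} := by rw [heq]; exact ⟨hr.refl _, h⟩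
      have hv : v ∈ {z | r a z ∧ r z b} := by rw [heq]; exact ⟨h, hr.refl _⟩
      rcases hab with hab | hab
      · exact hab hu.1
      · exact hab hv.2
    refine (ih _ (hlt u z (hr.refl _) h2 (Or.inr ?_)) u z rfl h1).trans
      (ih _ (hlt z v h1 (hr.refl _) (Or.inl ?_)) z v rfl h2)
    · intro hvz; exact h4 (hr.antisymm _ _ h2 hvz)
    · intro hzu; exact h3 (hr.antisymm _ _ hzu h1)
  exact key _ u v rfl h

lemma rel_iff_covers {n : ℕ} (r : Lit n → Lit n → Prop) (hr : IsPartialOrder _ r) (u v : Lit n) :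
    r u v ↔ Relation.ReflTransGen (Covers r) u v := by
  constructor
  · exact rel_covers r hr
  · intro h
    induction h with
    | refl => exact hr.refl _
    | tail _ h ih => exact hr.trans _ _ _ ih h.2.1

/-- `c` and `β` encode the covers of `P`. -/
def Enc {n : ℕ} (P : LitPoset n) (β : Fin n → Bool) (c : Fin n → Fin n → Option Bool) : Prop :=
  ∀ i j b b', Covers P.1 (i, b) (j, b') ↔
    (b = β i ∧ b' = !β j ∧ c i j = some true) ∨ (b = !β i ∧ b' = β j ∧ c i j = some false)

lemma Enc.inj {n : ℕ} {P P' : LitPoset n} {β : Fin n → Bool} {c : Fin n → Fin n → Option Bool}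
    (h : Enc P β c) (h' : Enc P' β c) : P = P' := by
  apply Subtype.ext
  have hc : Covers P.1 = Covers P'.1 := by
    funext u v
    exact propext ((h u.1 v.1 u.2 v.2).trans (h' u.1 v.1 u.2 v.2).symm)
  funext u v
  apply propext
  rw [rel_iff_covers P.1 P.2.1, rel_iff_covers P'.1 P'.2.1, hc]

/-- support of `c` is a graph that is not triangle connected -/
def NTC {n : ℕ} (c : Fin n → Fin n → Option Bool) : Prop :=
  ∃ G : ColoredGraph n, (∀ x y, G.Adj x y ↔ c x y ≠ none) ∧ ¬ TriConnected G

lemma bar_bar {n : ℕ} (u : Lit n) : u.bar.bar = u := by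
  rcases u with ⟨i, b⟩; simp [Lit.bar]

lemma covers_bar {n : ℕ} (P : LitPoset n) {u v : Lit n} (h : Covers P.1 u v) :
    Covers P.1 v.bar u.bar := by
  have hd := P.2.2.2
  refine ⟨?_, (hd _ _).1 h.2.1, ?_⟩
  · intro e
    apply h.1
    rw [← bar_bar u, ← e, bar_bar]
  · intro z h1 h2
    have h1' := (hd _ _).1 h1
    have h2' := (hd _ _).1 h2
    rw [bar_bar] at h1' h2'
    rcases h.2.2 _ h2' h1' with e | e
    · right; rw [← e, bar_bar]
    · left; rw [← e, bar_bar]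

lemma exists_enc {n : ℕ} (P : LitPoset n) (G : ColoredGraph n) (hG : GraphOf P G)
    (hB : G.BlueBipartite) (hT : ¬ TriConnected G) :
    ∃ (β : Fin n → Bool) (c : Fin n → Fin n → Option Bool), Enc P β c ∧ Valid c ∧ NTC c := by
  classical
  obtain ⟨U, -, hU⟩ := hB
  obtain ⟨hpo, hinc, hdual⟩ := P.2
  have hne : ∀ i j b b', Covers P.1 (i, b) (j, b') → i ≠ j := by
    rintro i j b b' h rfl
    by_cases hb : b' = b
    · subst hb; exact h.1 rfl
    · have : b' = !b := by rcases b with _ | _ <;> rcases b' with _ | _ <;> simp at hb ⊢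
      subst this
      exact hinc _ _ h.2.1
  obtain ⟨β, hβ⟩ : ∃ β : Fin n → Bool, ∀ i, β i = true ↔ i ∈ U :=
    ⟨fun i => decide (i ∈ U), fun i => by simp⟩
  have hred : ∀ i j, G.red.Adj i j → β i = β j := by
    intro i j h
    have := (hU i trivial j trivial).2 h
    rw [← hβ, ← hβ] at this
    exact Bool.eq_iff_iff.2 this
  have hblue : ∀ i j, G.blue.Adj i j → β i = !β j := by
    intro i j h
    have := (hU i trivial j trivial).1 h
    rw [← hβ, ← hβ] at this
    apply Bool.eq_iff_iff.2
    simpa using this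
  have hadj : ∀ i j, G.Adj i j ↔ ∃ b b', Covers P.1 (i, b) (j, b') := by
    intro i j
    have : G.Adj i j ↔ G.red.Adj i j ∨ G.blue.Adj i j := Iff.rfl
    rw [this, (hG i j).1, (hG i j).2]
    constructor
    · rintro (⟨-, h | h⟩ | ⟨-, h | h⟩) <;> exact ⟨_, _, h⟩
    · rintro ⟨b, b', h⟩
      have h0 := hne _ _ _ _ h
      rcases b with _ | _ <;> rcases b' with _ | _ <;> tauto
  have hcov : ∀ i j b b', Covers P.1 (i, b) (j, b') →
      (b = β i ∧ b' = !β j) ∨ (b = !β i ∧ b' = β j) := by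
    intro i j b b' h
    have h0 := hne _ _ _ _ h
    by_cases hb : b = b'
    · subst hb
      have : β i = !β j := by
        apply hblue
        rw [(hG i j).2]
        refine ⟨h0, ?_⟩
        rcases b with _ | _
        · exact Or.inl h
        · exact Or.inr h
      rw [this]; rcases β j with _ | _ <;> rcases b with _ | _ <;> simp
    · have hb' : b' = !b := by rcases b with _ | _ <;> rcases b' with _ | _ <;> simp at hb ⊢
      subst hb'
      have : β i = β j := by
        apply hred
        rw [(hG i j).1]
        refine ⟨h0, ?_⟩
        rcases b with _ | _
        · exact Or.inl h
        · exact Or.inr h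
      rw [this]; rcases β j with _ | _ <;> rcases b with _ | _ <;> simp
  have hnot : ∀ i j, Covers P.1 (i, β i) (j, !β j) → Covers P.1 (i, !β i) (j, β j) → False := by
    intro i j h1 h2
    have h3 := covers_bar P h2
    simp only [Lit.bar, Bool.not_not] at h3
    exact h1.1 (hpo.antisymm _ _ h1.2.1 h3.2.1)
  obtain ⟨c, hc⟩ : ∃ c : Fin n → Fin n → Option Bool, c = fun i j =>
    if Covers P.1 (i, β i) (j, !β j) then some true else
      if Covers P.1 (i, !β i) (j, β j) then some false else none := ⟨_, rfl⟩
  have ct : ∀ i j, c i j = some true ↔ Covers P.1 (i, β i) (j, !β j) := by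
    intro i j
    rw [hc]
    by_cases h1 : Covers P.1 (i, β i) (j, !β j)
    · simp [h1]
    · by_cases h2 : Covers P.1 (i, !β i) (j, β j) <;> simp [h1, h2]
  have cf : ∀ i j, c i j = some false ↔ Covers P.1 (i, !β i) (j, β j) := by
    intro i j
    rw [hc]
    by_cases h1 : Covers P.1 (i, β i) (j, !β j)
    · have h2 : ¬ Covers P.1 (i, !β i) (j, β j) := fun h => hnot i j h1 h
      simp [h1, h2]
    · by_cases h2 : Covers P.1 (i, !β i) (j, β j) <;> simp [h1, h2]
  clear hc
  have henc : Enc P β c := by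
    intro i j b b'
    constructor
    · intro h
      rcases hcov _ _ _ _ h with ⟨rfl, rfl⟩ | ⟨rfl, rfl⟩
      · exact Or.inl ⟨rfl, rfl, (ct _ _).2 h⟩
      · exact Or.inr ⟨rfl, rfl, (cf _ _).2 h⟩
    · rintro (⟨rfl, rfl, h⟩ | ⟨rfl, rfl, h⟩)
      · exact (ct _ _).1 h
      · exact (cf _ _).1 h
  have st : ∀ i j, c i j = some true → c j i = some true := by
    intro i j h
    rw [ct] at h ⊢
    have := covers_bar P h
    simpa [Lit.bar] using this
  have sf : ∀ i j, c i j = some false → c j i = some false := by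
    intro i j h
    rw [cf] at h ⊢
    have := covers_bar P h
    simpa [Lit.bar] using this
  have hinc' : ∀ i b, ¬ P.1 (i, !b) (i, b) := by
    intro i b h
    have := hinc i (!b)
    rw [Bool.not_not] at this
    exact this h
  have tr := hpo.trans
  refine ⟨β, c, henc, ⟨?_, ?_, ?_⟩, G, ?_, hT⟩
  · intro x y
    rcases h : c x y with _ | _ | _
    · rcases h' : c y x with _ | _ | _
      · rfl
      · rw [sf _ _ h'] at h; simp at h
      · rw [st _ _ h'] at h; simp at h
    · exact (sf _ _ h).symm
    · exact (st _ _ h).symm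
  · intro x
    rcases h : c x x with _ | _ | _
    · rfl
    · exact absurd rfl (hne _ _ _ _ ((cf _ _).1 h))
    · exact absurd rfl (hne _ _ _ _ ((ct _ _).1 h))
  · have lt : ∀ x y, c x y = some true → P.1 (x, β x) (y, !β y) := fun x y h => ((ct _ _).1 h).2.1
    have lf : ∀ x y, c x y = some false → P.1 (x, !β x) (y, β y) := fun x y h => ((cf _ _).1 h).2.1
    intro x y z a b h1 h2 h3
    by_contra hab
    rcases a with _ | _ <;> rcases b with _ | _
    · exact hab rfl
    · rcases h : c x z with _ | _ | _
      · exact h3 h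
      · exact hinc' x _ (tr _ _ _ (tr _ _ _ (lf x z h) (lt z y (st _ _ h2))) (lf y x (sf _ _ h1)))
      · exact hinc z _ (tr _ _ _ (tr _ _ _ (lt z y (st _ _ h2)) (lf y x (sf _ _ h1))) (lt x z h))
    · rcases h : c x z with _ | _ | _
      · exact h3 h
      · exact hinc' z _ (tr _ _ _ (tr _ _ _ (lf z x (sf _ _ h)) (lt x y h1)) (lf y z h2))
      · exact hinc x _ (tr _ _ _ (tr _ _ _ (lt x y h1) (lf y z h2)) (lt z x (st _ _ h)))
    · exact hab rfl
  · intro x y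
    rw [hadj]
    constructor
    · rintro ⟨b, b', h⟩
      rcases (henc _ _ _ _).1 h with h | h <;> rw [h.2.2] <;> simp
    · intro h
      rcases h' : c x y with _ | _ | _
      · exact absurd h' h
      · exact ⟨_, _, (cf _ _).1 h'⟩
      · exact ⟨_, _, (ct _ _).1 h'⟩

lemma triEquiv_step {n : ℕ} (G : ColoredGraph n) {e f g : Sym2 (Fin n)}
    {T : Fin n × Fin n × Fin n} (hT : IsTri G T) (hf : EdgeOf f T) (hg : EdgeOf g T)
    (h : TriEquiv G e f) : TriEquiv G e g := by
  rcases h with rfl | ⟨l, S, h1, h2, h3, h4⟩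
  · exact Or.inr ⟨0, fun _ => T, fun _ _ => hT, hf, hg, fun i hi => absurd hi (by omega)⟩
  · refine Or.inr ⟨l + 1, fun i => if i ≤ l then S i else T, ?_, ?_, ?_, ?_⟩
    · intro i hi
      by_cases hil : i ≤ l
      · simpa [hil] using h1 i hil
      · simpa [hil] using hT
    · simpa using h2
    · simpa using hg
    · intro i hi
      by_cases hil : i + 1 ≤ l
      · have : i ≤ l := by omega
        simpa [hil, this] using h4 i (by omega)
      · have hi' : i = l := by omega
        subst hi'
        exact ⟨f, by simpa using h3, by simpa using hf⟩

lemma recolor {n : ℕ} (c : Fin n → Fin n → Option Bool) (hN : NTC c) :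
    ∃ c' : Fin n → Fin n → Option Bool, Valid c' ∧ NM c' ∧ ∀ x y, c' x y = none ↔ c x y = none := by
  classical
  obtain ⟨G, hG, hT⟩ := hN
  simp only [TriConnected, not_forall] at hT
  obtain ⟨e, he, f, hf, hef⟩ := hT
  have symm : ∀ x y, G.Adj x y → G.Adj y x := fun x y h => SimpleGraph.Adj.symm (G := G.graph) h
  have hne : ∀ x, ¬ G.Adj x x := fun x h => G.graph.loopless.irrefl x h
  obtain ⟨c', hc'⟩ : ∃ c' : Fin n → Fin n → Option Bool, c' = fun x y =>
    if G.Adj x y then (if TriEquiv G e s(x, y) then some true else some false) else none := ⟨_, rfl⟩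
  have hnone : ∀ x y, c' x y = none ↔ ¬ G.Adj x y := by
    intro x y
    rw [hc']
    by_cases h1 : G.Adj x y <;> by_cases h2 : TriEquiv G e s(x, y) <;> simp [h1, h2]
  have htrue : ∀ x y, c' x y = some true ↔ G.Adj x y ∧ TriEquiv G e s(x, y) := by
    intro x y
    rw [hc']
    by_cases h1 : G.Adj x y <;> by_cases h2 : TriEquiv G e s(x, y) <;> simp [h1, h2]
  have hfalse : ∀ x y, c' x y = some false ↔ G.Adj x y ∧ ¬ TriEquiv G e s(x, y) := by
    intro x y
    rw [hc']
    by_cases h1 : G.Adj x y <;> by_cases h2 : TriEquiv G e s(x, y) <;> simp [h1, h2]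
  refine ⟨c', ⟨?_, ?_, ?_⟩, ?_, ?_⟩
  · intro x y
    have : G.Adj x y ↔ G.Adj y x := ⟨symm _ _, symm _ _⟩
    simp only [hc', this, Sym2.eq_swap (a := x) (b := y)]
  · intro x
    rw [hnone]; exact hne x
  · intro x y z a b h1 h2 h3
    have h3' : G.Adj x z := by
      by_contra h; exact h3 ((hnone _ _).2 h)
    have hxy : G.Adj x y := by
      by_contra h; rw [(hnone _ _).2 h] at h1; simp at h1
    have hyz : G.Adj y z := by
      by_contra h; rw [(hnone _ _).2 h] at h2; simp at h2
    have htri : IsTri G (x, y, z) := ⟨hxy, hyz, h3'⟩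
    have e1 : EdgeOf s(x, y) (x, y, z) := Or.inl rfl
    have e2 : EdgeOf s(y, z) (x, y, z) := Or.inr (Or.inl rfl)
    rcases a with _ | _ <;> rcases b with _ | _
    · rfl
    · exact absurd (triEquiv_step G htri e2 e1 ((htrue _ _).1 h2).2) ((hfalse _ _).1 h1).2
    · exact absurd (triEquiv_step G htri e1 e2 ((htrue _ _).1 h1).2) ((hfalse _ _).1 h2).2
    · rfl
  · rintro (_ | _)
    · induction f using Sym2.ind with
      | _ x y => exact ⟨x, y, (hfalse _ _).2 ⟨hf, hef⟩⟩
    · induction e using Sym2.ind with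
      | _ x y => exact ⟨x, y, (htrue _ _).2 ⟨he, Or.inl rfl⟩⟩
  · intro x y
    rw [hnone, hG, not_not]

lemma count_NTC (n : ℕ) :
    {c : Fin n → Fin n → Option Bool | Valid c ∧ NTC c}.ncard ≤
      3 * {c : Fin n → Fin n → Option Bool | Valid c ∧ NM c}.ncard := by
  classical
  have hmono : ∀ a, {c : Fin n → Fin n → Option Bool | NTC c ∧ ∀ x y, c x y ≠ some a}.ncard ≤
      {c : Fin n → Fin n → Option Bool | Valid c ∧ NM c}.ncard := by
    intro a
    have hex : ∀ c : Fin n → Fin n → Option Bool, ∃ c' : Fin n → Fin n → Option Bool, NTC c →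
        Valid c' ∧ NM c' ∧ ∀ x y, c' x y = none ↔ c x y = none := by
      intro c
      by_cases h : NTC c
      · obtain ⟨c', h'⟩ := recolor c h
        exact ⟨c', fun _ => h'⟩
      · exact ⟨c, fun h' => absurd h' h⟩
    choose φ hφ using hex
    apply Set.ncard_le_ncard_of_injOn φ
    · intro c hc
      exact ⟨(hφ c hc.1).1, (hφ c hc.1).2.1⟩
    · intro c hc d hd hcd
      funext x y
      have h1 := (hφ c hc.1).2.2 x y
      have h2 := (hφ d hd.1).2.2 x y
      rw [hcd] at h1
      have h3 := h1.symm.trans h2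
      have h4 := hc.2 x y
      have h5 := hd.2 x y
      revert h3 h4 h5
      generalize c x y = p
      generalize d x y = q
      clear * -
      revert a p q
      decide
  have hcov : {c : Fin n → Fin n → Option Bool | Valid c ∧ NTC c} ⊆
      ({c | NTC c ∧ ∀ x y, c x y ≠ some true} ∪ {c | NTC c ∧ ∀ x y, c x y ≠ some false}) ∪
        {c | Valid c ∧ NM c} := by
    rintro c ⟨hc, hn⟩
    by_cases h1 : ∀ x y, c x y ≠ some true
    · exact Or.inl (Or.inl ⟨hn, h1⟩)
    by_cases h2 : ∀ x y, c x y ≠ some false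
    · exact Or.inl (Or.inr ⟨hn, h2⟩)
    refine Or.inr ⟨hc, ?_⟩
    push Not at h1 h2
    rintro (_ | _)
    · exact h2
    · exact h1
  have h := (Set.ncard_le_ncard hcov (Set.toFinite _)).trans ((Set.ncard_union_le _ _).trans
    (Nat.add_le_add_right ((Set.ncard_union_le _ _).trans
      (Nat.add_le_add (hmono true) (hmono false))) _))
  omega

lemma count_posets (n : ℕ) :
    {P : LitPoset n | ∃ G : ColoredGraph n,
          GraphOf P G ∧ G.BlueBipartite ∧ ¬ TriConnected G}.ncard ≤
      2 ^ n * (3 * {c : Fin n → Fin n → Option Bool | Valid c ∧ NM c}.ncard) := by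
  classical
  have hex : ∀ P : LitPoset n, ∃ q : (Fin n → Bool) × (Fin n → Fin n → Option Bool),
      (∃ G : ColoredGraph n, GraphOf P G ∧ G.BlueBipartite ∧ ¬ TriConnected G) →
      Enc P q.1 q.2 ∧ Valid q.2 ∧ NTC q.2 := by
    intro P
    by_cases h : ∃ G : ColoredGraph n, GraphOf P G ∧ G.BlueBipartite ∧ ¬ TriConnected G
    · obtain ⟨G, h1, h2, h3⟩ := h
      obtain ⟨β, c, h⟩ := exists_enc P G h1 h2 h3
      exact ⟨(β, c), fun _ => h⟩
    · exact ⟨(fun _ => true, fun _ _ => none), fun h' => absurd h' h⟩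
  choose φ hφ using hex
  have h1 : {P : LitPoset n | ∃ G : ColoredGraph n,
          GraphOf P G ∧ G.BlueBipartite ∧ ¬ TriConnected G}.ncard ≤
      ((Set.univ : Set (Fin n → Bool)) ×ˢ
        {c : Fin n → Fin n → Option Bool | Valid c ∧ NTC c}).ncard := by
    apply Set.ncard_le_ncard_of_injOn φ
    · intro P hP
      exact ⟨trivial, (hφ P hP).2⟩
    · intro P hP Q hQ h
      have h2 := (hφ P hP).1
      rw [h] at h2
      exact h2.inj (hφ Q hQ).1
  refine h1.trans ?_
  rw [Set.ncard_prod, Set.ncard_univ, Nat.card_eq_fintype_card]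
  simp only [Fintype.card_fun, Fintype.card_bool, Fintype.card_fin]
  exact Nat.mul_le_mul_left _ (count_NTC n)

end FNT

/-- Lemma 4.2: there are `c > 0` and `N` such that for all `n ≥ N`, the number of
`P ∈ 𝓟(n)` whose graph `G(P)` is blue-bipartite but not triangle-connected is at
most `2^{-cn} b(n)`. -/
theorem few_not_triangle_connected :
    ∃ c : ℝ, 0 < c ∧ ∃ N : ℕ, ∀ n : ℕ, N ≤ n →
      ({P : LitPoset n | ∃ G : ColoredGraph n,
          GraphOf P G ∧ G.BlueBipartite ∧ ¬ TriConnected G}.ncard : ℝ) ≤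
        (2 : ℝ) ^ (-(c * n)) * bnum n := by
  obtain ⟨M, N0, hM, hN0⟩ := FNT.main_count
  obtain ⟨N1, hN1⟩ := FNT.poly_exp 0 (6 * M) (9/10) (19/20) (by positivity) (by norm_num)
    (by norm_num)
  refine ⟨Real.logb 2 (20/19), Real.logb_pos (by norm_num) (by norm_num), N0 + N1 + 1, ?_⟩
  intro n hn
  have h1 := (Nat.cast_le (α := ℝ)).2 (FNT.count_posets n)
  have h2 := hN0 (Fin n) (by rw [Fintype.card_fin]; omega)
  rw [Fintype.card_fin] at h2
  have h3 := hN1 n (by omega)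
  have e1 : (2:ℝ) ^ (-(Real.logb 2 (20/19) * n)) = (19/20) ^ n := by
    rw [← neg_mul, Real.rpow_mul (by norm_num), Real.rpow_natCast, Real.rpow_neg (by norm_num),
      Real.rpow_logb (by norm_num) (by norm_num) (by norm_num)]
    norm_num
  have e2 : (2:ℝ) * (bnum n : ℝ) = 2 ^ n.choose 2 * 2 ^ n := by
    have hc : n * (n + 1) / 2 = n.choose 2 + n := by
      rw [← FNT.choose_two_succ, Nat.choose_two_right, Nat.add_sub_cancel, mul_comm]
    obtain ⟨m, rfl⟩ : ∃ m, n = m + 1 := ⟨n - 1, by omega⟩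
    unfold bnum
    rw [hc, show (m+1).choose 2 + (m + 1) - 1 = (m+1).choose 2 + m by omega]
    push_cast
    rw [pow_add, pow_succ]
    ring
  rw [e1]
  refine h1.trans ?_
  push_cast
  rw [pow_zero, mul_one] at h3
  calc (2:ℝ) ^ n * (3 * ({c : Fin n → Fin n → Option Bool | FNT.Valid c ∧ FNT.NM c}.ncard : ℝ))
      ≤ (2:ℝ) ^ n * (3 * (M * (9/10) ^ n * 2 ^ n.choose 2)) := by gcongr
    _ = (6 * M * (9/10) ^ n) * (2 ^ n.choose 2 * 2 ^ n) / 2 := by ring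
    _ ≤ (19/20) ^ n * (2 ^ n.choose 2 * 2 ^ n) / 2 := by gcongr
    _ = (19/20) ^ n * bnum n := by rw [← e2]; ring
end
end

section
/- There exist constants Δ > 0 and c > 0 such that for every n ≥ 1: F(n) ≤ (1 + Δ·2^{−c·n})·2^{n(n+1)/2−1}. -/
open Filter

noncomputable section

theorem weighted_count {α β K V R : Type*} [Fintype K] [Nonempty K] [Fintype V] [Fintype R] [DecidableEq β]
    (A : Finset α) (d : α → β) (row : α → V → R)
    (inj : ∀ a ∈ A, ∀ b ∈ A, d a = d b → row a = row b → a = b)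
    (φ : β → K → V → R → ℝ) (hφ : ∀ b k w r, 0 ≤ φ b k w r) (c M : ℝ) (hM : 0 ≤ M)
    (h : ∀ a ∈ A, ∃ k, c ≤ ∏ w, φ (d a) k w (row a w) ∧ ∏ w, ∑ r, φ (d a) k w r ≤ M) :
    (A.card : ℝ) * c ≤ (A.image d).card * Fintype.card K * M := by
  classical
  choose! k hk using h
  have h1 : (A.card : ℝ) * c ≤ ∑ a ∈ A, ∏ w, φ (d a) (k a) w (row a w) := by
    rw [← nsmul_eq_mul]
    exact Finset.card_nsmul_le_sum _ _ _ (fun a ha => (hk a ha).1)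
  let T : Finset (β × K) := ((A.image d) ×ˢ (Finset.univ : Finset K)).filter
    (fun p => ∏ w, ∑ r, φ p.1 p.2 w r ≤ M)
  have h2 : ∑ a ∈ A, ∏ w, φ (d a) (k a) w (row a w)
      ≤ ∑ x ∈ T ×ˢ (Finset.univ : Finset (V → R)), ∏ w, φ x.1.1 x.1.2 w (x.2 w) := by
    rw [← Finset.sum_image (s := A) (g := fun a => ((d a, k a), row a))
      (f := fun x : (β × K) × (V → R) => ∏ w, φ x.1.1 x.1.2 w (x.2 w))]
    · apply Finset.sum_le_sum_of_subset_of_nonneg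
      · intro x hx
        obtain ⟨a, ha, rfl⟩ := Finset.mem_image.1 hx
        simp only [T, Finset.mem_product, Finset.mem_filter, Finset.mem_univ, and_true]
        exact ⟨Finset.mem_image_of_mem _ ha, (hk a ha).2⟩
      · intro x _ _
        exact Finset.prod_nonneg (fun w _ => hφ _ _ _ _)
    · intro a ha b hb hab
      simp only [Prod.mk.injEq] at hab
      exact inj a ha b hb hab.1.1 hab.2
  have h3 : ∑ x ∈ T ×ˢ (Finset.univ : Finset (V → R)), ∏ w, φ x.1.1 x.1.2 w (x.2 w)
      ≤ ∑ p ∈ T, M := by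
    rw [Finset.sum_product]
    apply Finset.sum_le_sum
    intro p hp
    have := (Finset.mem_filter.1 hp).2
    rw [Finset.prod_univ_sum] at this
    simpa using this
  have h4 : ∑ p ∈ T, M ≤ (A.image d).card * Fintype.card K * M := by
    rw [Finset.sum_const, nsmul_eq_mul]
    apply mul_le_mul_of_nonneg_right _ hM
    have : T.card ≤ (A.image d).card * Fintype.card K := by
      refine (Finset.card_filter_le _ _).trans ?_
      rw [Finset.card_product, Finset.card_univ]
    exact_mod_cast this
  linarith

/-- signed-graph version of odd-blue-triangle-free colored graphs -/
def IsOB {V : Type*} (G : V → V → SignType) : Prop :=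
  (∀ x y, G x y = G y x) ∧ (∀ x, G x x = 0) ∧ ∀ x y z, G x y * G y z * G x z ≠ -1

open scoped Classical in
def obFin (n : ℕ) : Finset (Fin n → Fin n → SignType) := Finset.univ.filter IsOB

def fOB (n : ℕ) : ℕ := (obFin n).card

theorem mem_obFin {n : ℕ} {G : Fin n → Fin n → SignType} : G ∈ obFin n ↔ IsOB G := by
  simp [obFin]

open scoped Classical in
def del {n : ℕ} (S : Finset (Fin n)) (G : Fin n → Fin n → SignType) :
    Fin n → Fin n → SignType := fun x y => if x ∈ S ∨ y ∈ S then 0 else G x y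

theorem del_of_notMem {n : ℕ} {S : Finset (Fin n)} {G : Fin n → Fin n → SignType} {x y : Fin n}
    (hx : x ∉ S) (hy : y ∉ S) : del S G x y = G x y := by simp [del, hx, hy]

theorem del_right {n : ℕ} {S : Finset (Fin n)} {G : Fin n → Fin n → SignType} {x y : Fin n}
    (hy : y ∈ S) : del S G x y = 0 := by simp [del, hy]

open scoped Classical in
theorem card_image_del {n : ℕ} (S : Finset (Fin n)) (A : Finset (Fin n → Fin n → SignType))
    (hA : A ⊆ obFin n) : (A.image (del S)).card ≤ fOB (n - S.card) := by
  have hc : Fintype.card {x : Fin n // x ∉ S} = n - S.card := by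
    rw [Fintype.card_subtype_compl]; simp
  let e : {x : Fin n // x ∉ S} ≃ Fin (n - S.card) := Fintype.equivFinOfCardEq hc
  let ρ : (Fin n → Fin n → SignType) → Fin (n - S.card) → Fin (n - S.card) → SignType :=
    fun G i j => G (e.symm i) (e.symm j)
  apply Finset.card_le_card_of_injOn ρ
  · intro H hH
    obtain ⟨G, hG, rfl⟩ := Finset.mem_image.1 hH
    have hG := mem_obFin.1 (hA hG)
    have hd : ∀ i j, ρ (del S G) i j = G (e.symm i) (e.symm j) := fun i j =>
      del_of_notMem (e.symm i).2 (e.symm j).2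
    rw [Finset.mem_coe, mem_obFin]
    refine ⟨?_, ?_, ?_⟩
    · intro x y; rw [hd, hd]; exact hG.1 _ _
    · intro x; rw [hd]; exact hG.2.1 _
    · intro x y z; rw [hd, hd, hd]; exact hG.2.2 _ _ _
  · intro H hH H' hH' hh
    obtain ⟨G, hG, rfl⟩ := Finset.mem_image.1 hH
    obtain ⟨G', hG', rfl⟩ := Finset.mem_image.1 hH'
    funext x y
    by_cases hx : x ∈ S
    · simp [del, hx]
    by_cases hy : y ∈ S
    · simp [del, hy]
    have := congrFun (congrFun hh (e ⟨x, hx⟩)) (e ⟨y, hy⟩)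
    simpa [ρ] using this

theorem one_del {n : ℕ} {K : Type*} [Fintype K] [Nonempty K] (u : Fin n)
    (A : Finset (Fin n → Fin n → SignType)) (hA : A ⊆ obFin n)
    (φ : (Fin n → Fin n → SignType) → K → Fin n → SignType → ℝ)
    (hφ : ∀ b k w r, 0 ≤ φ b k w r) (c M : ℝ) (hM : 0 ≤ M)
    (h : ∀ G ∈ A, ∃ k, c ≤ ∏ w, φ (del {u} G) k w (G u w) ∧ ∏ w, ∑ r, φ (del {u} G) k w r ≤ M) :
    (A.card : ℝ) * c ≤ fOB (n - 1) * Fintype.card K * M := by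
  classical
  refine (weighted_count A (del {u}) (fun G w => G u w) ?_ φ hφ c M hM h).trans ?_
  · intro G hG G' hG' hd hr
    have hG := mem_obFin.1 (hA hG)
    have hG' := mem_obFin.1 (hA hG')
    funext x y
    by_cases hx : x = u
    · subst hx; exact congrFun hr y
    by_cases hy : y = u
    · subst hy; rw [hG.1, hG'.1]; exact congrFun hr x
    have := congrFun (congrFun hd x) y
    rwa [del_of_notMem (by simpa), del_of_notMem (by simpa)] at this
    all_goals simpa
  · have := card_image_del {u} A hA
    rw [Finset.card_singleton] at this
    gcongr

theorem two_del {n : ℕ} {K : Type*} [Fintype K] [Nonempty K] (u v : Fin n) (huv : u ≠ v)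
    (A : Finset (Fin n → Fin n → SignType)) (hA : A ⊆ obFin n)
    (φ : (Fin n → Fin n → SignType) → K → Fin n → SignType × SignType → ℝ)
    (hφ : ∀ b k w r, 0 ≤ φ b k w r) (c M : ℝ) (hM : 0 ≤ M)
    (h : ∀ G ∈ A, ∃ k, c ≤ ∏ w, φ (del {u, v} G) k w (G u w, G v w) ∧
      ∏ w, ∑ r, φ (del {u, v} G) k w r ≤ M) :
    (A.card : ℝ) * c ≤ fOB (n - 2) * Fintype.card K * M := by
  classical
  refine (weighted_count A (del {u, v}) (fun G w => (G u w, G v w)) ?_ φ hφ c M hM h).trans ?_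
  · intro G hG G' hG' hd hr
    have hG := mem_obFin.1 (hA hG)
    have hG' := mem_obFin.1 (hA hG')
    have hu : ∀ w, G u w = G' u w := fun w => congrArg Prod.fst (congrFun hr w)
    have hv : ∀ w, G v w = G' v w := fun w => congrArg Prod.snd (congrFun hr w)
    funext x y
    by_cases hx : x ∈ ({u, v} : Finset (Fin n))
    · simp only [Finset.mem_insert, Finset.mem_singleton] at hx
      rcases hx with rfl | rfl
      · exact hu y
      · exact hv y
    by_cases hy : y ∈ ({u, v} : Finset (Fin n))
    · simp only [Finset.mem_insert, Finset.mem_singleton] at hy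
      rw [hG.1, hG'.1]
      rcases hy with rfl | rfl
      · exact hu x
      · exact hv x
    have := congrFun (congrFun hd x) y
    rwa [del_of_notMem hx hy, del_of_notMem hx hy] at this
  · have := card_image_del {u, v} A hA
    rw [Finset.card_pair huv] at this
    gcongr
open scoped Classical in
/-- predicted sign of the edge from the certified vertex to `w` -/
def pred {n : ℕ} (G : Fin n → Fin n → SignType) (P : Finset (Fin n × SignType)) (w : Fin n) :
    SignType :=
  if ∃ p ∈ P, G p.1 w * p.2 = 1 then 1 else if ∃ p ∈ P, G p.1 w * p.2 = -1 then -1 else 0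

def Cert {n : ℕ} (G : Fin n → Fin n → SignType) (v x : Fin n) (P : Finset (Fin n × SignType)) :
    Prop := ∀ p ∈ P, p.2 = G v p.1 ∧ G v p.1 ≠ 0 ∧ p.1 ≠ x

open scoped Classical in
/-- the set of vertices with no prediction -/
def Wset {n : ℕ} (G : Fin n → Fin n → SignType) (P : Finset (Fin n × SignType)) :
    Finset (Fin n) := Finset.univ.filter (fun w => pred G P w = 0)

theorem mem_Wset {n : ℕ} {G : Fin n → Fin n → SignType} {P : Finset (Fin n × SignType)}
    {w : Fin n} : w ∈ Wset G P ↔ pred G P w = 0 := by simp [Wset]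

theorem pred_eq_zero {n : ℕ} {G : Fin n → Fin n → SignType} {P : Finset (Fin n × SignType)}
    {w : Fin n} : pred G P w = 0 ↔ ∀ p ∈ P, G p.1 w * p.2 = 0 := by
  unfold pred
  split_ifs with h1 h2
  · obtain ⟨p, hp, h⟩ := h1
    simp only [false_iff, not_forall]
    exact ⟨p, hp, by rw [h]; decide⟩
  · obtain ⟨p, hp, h⟩ := h2
    constructor
    · intro h; exact absurd h (by decide)
    · intro h'; have := h' p hp; rw [h] at this; exact absurd this (by decide)
  · simp only [true_iff]
    intro p hp
    push Not at h1 h2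
    have a := h1 p hp
    have b := h2 p hp
    generalize G p.1 w * p.2 = t at a b
    revert t; decide

theorem pred_spec {n : ℕ} {G : Fin n → Fin n → SignType} {P : Finset (Fin n × SignType)}
    {w : Fin n} (h : pred G P w ≠ 0) : ∃ p ∈ P, G p.1 w * p.2 = pred G P w := by
  unfold pred at *
  split_ifs at * with h1 h2
  · exact h1
  · exact h2
  · exact absurd rfl h

theorem pred_correct {n : ℕ} {G : Fin n → Fin n → SignType} (hG : IsOB G) {v x : Fin n}
    {P : Finset (Fin n × SignType)} (hP : Cert G v x P) {w : Fin n} (h : pred G P w ≠ 0)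
    (hw : G v w ≠ 0) : G v w = pred G P w := by
  obtain ⟨p, hp, e⟩ := pred_spec h
  obtain ⟨a, b, _⟩ := hP p hp
  have := hG.2.2 v p.1 w
  rw [← e] at h ⊢
  rw [a] at h ⊢
  clear a e hp
  generalize G v p.1 = r at *
  generalize G p.1 w = s at *
  generalize G v w = t at *
  revert r s t; decide

theorem pred_congr {n : ℕ} {G H : Fin n → Fin n → SignType} {P : Finset (Fin n × SignType)}
    {w : Fin n} (h : ∀ p ∈ P, G p.1 w = H p.1 w) : pred G P w = pred H P w := by
  have h1 : ∀ t, (∃ p ∈ P, G p.1 w * p.2 = t) ↔ (∃ p ∈ P, H p.1 w * p.2 = t) := by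
    intro t
    constructor
    · rintro ⟨p, hp, e⟩; exact ⟨p, hp, by rw [← h p hp]; exact e⟩
    · rintro ⟨p, hp, e⟩; exact ⟨p, hp, by rw [h p hp]; exact e⟩
  unfold pred
  simp only [h1]

theorem pred_del {n : ℕ} {G : Fin n → Fin n → SignType} {S : Finset (Fin n)}
    {P : Finset (Fin n × SignType)} {w : Fin n} (hw : w ∉ S) (h : ∀ p ∈ P, p.1 ∉ S) :
    pred (del S G) P w = pred G P w :=
  pred_congr (fun p hp => del_of_notMem (h p hp) hw)

theorem pred_del_mem {n : ℕ} {G : Fin n → Fin n → SignType} {S : Finset (Fin n)}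
    {P : Finset (Fin n × SignType)} {w : Fin n} (hw : w ∈ S) :
    pred (del S G) P w = 0 :=
  pred_eq_zero.2 (fun p _ => by rw [del_right hw, zero_mul])

open scoped Classical in
theorem exists_cert {n L M : ℕ} (hM : n < L * M) (G : Fin n → Fin n → SignType) (v x : Fin n) :
    ∃ P, Cert G v x P ∧ P.card ≤ L ∧ ∀ u, u ≠ x → G v u ≠ 0 →
      ((Wset G P).filter (fun w => G u w ≠ 0)).card ≤ M := by
  let N : Finset (Fin n × SignType) :=
    (Finset.univ.filter (fun u => u ≠ x ∧ G v u ≠ 0)).image (fun u => (u, G v u))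
  obtain ⟨P, hPN, hmin⟩ := Finset.exists_min_image N.powerset
    (fun P => (Wset G P).card + M * P.card) ⟨∅, by simp⟩
  have hPN' := Finset.mem_powerset.1 hPN
  have hcert : Cert G v x P := by
    intro p hp
    obtain ⟨u, hu, rfl⟩ := Finset.mem_image.1 (hPN' hp)
    simp only [Finset.mem_filter, Finset.mem_univ, true_and] at hu
    exact ⟨rfl, hu.2, hu.1⟩
  refine ⟨P, hcert, ?_, ?_⟩
  · have := hmin ∅ (by simp)
    have h2 : (Wset G ∅).card ≤ n := by simpa using Finset.card_le_univ (Wset G ∅)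
    simp only [Finset.card_empty, mul_zero, add_zero] at this
    have h3 : M * P.card < M * L := by
      rw [mul_comm M L]; omega
    exact (lt_of_mul_lt_mul_left h3 (Nat.zero_le _)).le
  · intro u hux hu
    have h1 := hmin (insert (u, G v u) P) (by
      rw [Finset.mem_powerset]
      apply Finset.insert_subset _ hPN'
      exact Finset.mem_image.2 ⟨u, by simp [hux, hu], rfl⟩)
    have h2 : Wset G (insert (u, G v u) P) ⊆ (Wset G P).filter (fun w => ¬ G u w ≠ 0) := by
      intro w hw
      rw [mem_Wset, pred_eq_zero] at hw
      rw [Finset.mem_filter, mem_Wset, pred_eq_zero]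
      refine ⟨fun p hp => hw p (Finset.mem_insert_of_mem hp), ?_⟩
      have := hw _ (Finset.mem_insert_self _ _)
      rcases mul_eq_zero.1 this with h | h
      · simpa using h
      · exact absurd h hu
    have h3 := Finset.card_le_card h2
    have h4 := Finset.card_filter_add_card_filter_not (s := Wset G P) (fun w => G u w ≠ 0)
    have h5 : M * (insert (u, G v u) P).card ≤ M * P.card + M := by
      rw [← Nat.mul_succ]
      exact Nat.mul_le_mul_left _ (Finset.card_insert_le _ _)
    omega

/-- certificates of bounded size -/
abbrev KL (n L : ℕ) : Type := {P : Finset (Fin n × SignType) // P.card ≤ L}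

instance (n L : ℕ) : Nonempty (KL n L) := ⟨⟨∅, by simp⟩⟩

theorem card_KL (n L : ℕ) : Fintype.card (KL n L) ≤ (3 * n + 1) ^ L := by
  classical
  have hc : Fintype.card (Fin L → Option (Fin n × SignType)) = (3 * n + 1) ^ L := by
    have : Fintype.card SignType = 3 := by decide
    simp [this, mul_comm]
  rw [← hc]
  apply Fintype.card_le_of_surjective (fun g : Fin L → Option (Fin n × SignType) =>
    if h : (Finset.univ.filter (fun p => ∃ i, g i = some p)).card ≤ L then
      (⟨Finset.univ.filter (fun p => ∃ i, g i = some p), h⟩ : KL n L) else ⟨∅, by simp⟩)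
  rintro ⟨P, hP⟩
  let g : Fin L → Option (Fin n × SignType) := fun i =>
    if h : i.1 < P.card then some (P.equivFin.symm ⟨i.1, h⟩).1 else none
  have hg : Finset.univ.filter (fun p => ∃ i, g i = some p) = P := by
    ext p
    simp only [Finset.mem_filter, Finset.mem_univ, true_and]
    constructor
    · rintro ⟨i, hi⟩
      simp only [g] at hi
      split_ifs at hi with h
      rw [← Option.some.inj hi]
      exact (P.equivFin.symm ⟨i.1, h⟩).2
    · intro hp
      refine ⟨⟨(P.equivFin ⟨p, hp⟩).1, (P.equivFin ⟨p, hp⟩).2.trans_le hP⟩, ?_⟩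
      simp [g]
  refine ⟨g, ?_⟩
  have : (Finset.univ.filter (fun p => ∃ i, g i = some p)).card ≤ L := by rw [hg]; exact hP
  simp only [dif_pos this]
  exact Subtype.ext hg

open scoped Classical in
theorem prod_ite_pow {n : ℕ} (A : Finset (Fin n)) (a : ℝ) :
    ∏ w, (if w ∈ A then a else 1) = a ^ A.card := by
  rw [Finset.prod_ite]; simp
open scoped Classical in
def Bad0 {n : ℕ} (L : ℕ) (G : Fin n → Fin n → SignType) (v : Fin n) : Prop :=
  (Finset.univ.filter (fun w => G v w ≠ 0)).card ≤ L + 2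

open scoped Classical in
def Bad1 {n : ℕ} (L M : ℕ) (G : Fin n → Fin n → SignType) (u : Fin n) : Prop :=
  ∃ Q P : Finset (Fin n × SignType), Q.card ≤ L ∧ P.card ≤ L ∧ (∀ p ∈ Q, p.1 ≠ u) ∧
    Cert G u u P ∧ 20 * M ≤ (Wset G Q).card ∧ (Wset G P).card ≤ (Wset G Q).card ∧
    ((Wset G Q).filter (fun w => G u w ≠ 0)).card ≤ M

open scoped Classical in
def Bad2 {n : ℕ} (L M : ℕ) (G : Fin n → Fin n → SignType) (u : Fin n) : Prop :=
  ∃ Q P : Finset (Fin n × SignType), Q.card ≤ L ∧ P.card ≤ L ∧ Cert G u u Q ∧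
    Cert G u u P ∧ (Wset G Q).card ≤ 20 * M ∧
    20 * M + 1 ≤ (Finset.univ.filter (fun w => pred G Q w * pred G P w = -1)).card

open scoped Classical in
def Bad3 {n : ℕ} (L M : ℕ) (G : Fin n → Fin n → SignType) (u v : Fin n) : Prop :=
  ∃ Q P : Finset (Fin n × SignType), ∃ t : SignType, Q.card ≤ L ∧ P.card ≤ L ∧ Cert G u v Q ∧
    Cert G v u P ∧ (Wset G Q).card ≤ 20 * M ∧ (Wset G P).card ≤ 20 * M ∧ t ≠ 0 ∧
    160 * M + 2 ≤ (Finset.univ.filter (fun w => pred G Q w * pred G P w = t)).card ∧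
    ∀ w, pred G Q w * pred G P w = t → G u w = 0 ∨ G v w = 0

theorem cert_ne {n : ℕ} {G : Fin n → Fin n → SignType} (hG : IsOB G) {v x : Fin n}
    {P : Finset (Fin n × SignType)} (hP : Cert G v x P) : ∀ p ∈ P, p.1 ≠ v := by
  intro p hp h
  have := (hP p hp).2.1
  rw [h, hG.2.1] at this
  exact this rfl

theorem sum_sign (g : SignType → ℝ) : ∑ r, g r = g 0 + g (-1) + g 1 := by
  have : (Finset.univ : Finset SignType) = {0, -1, 1} := by decide
  rw [this]
  rw [Finset.sum_insert (by decide), Finset.sum_insert (by decide), Finset.sum_singleton]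
  ring

open scoped Classical in
theorem count0 {n L : ℕ} (v : Fin n) :
    (((obFin n).filter (fun G => Bad0 L G v)).card : ℝ) * (1 / 10) ^ (L + 2)
      ≤ fOB (n - 1) * 1 * (6 / 5) ^ n := by
  have := one_del (K := Unit) v ((obFin n).filter (fun G => Bad0 L G v)) (Finset.filter_subset _ _)
    (fun _ _ _ r => if r ≠ 0 then 1 / 10 else 1) (by intros; split_ifs <;> norm_num)
    ((1 / 10) ^ (L + 2)) ((6 / 5) ^ n) (by positivity) ?_
  · simpa using this
  · intro G hG
    have hb := (Finset.mem_filter.1 hG).2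
    refine ⟨(), ?_, ?_⟩
    · rw [Finset.prod_ite, Finset.prod_const, Finset.prod_const_one, mul_one]
      exact pow_le_pow_of_le_one (by norm_num) (by norm_num) hb
    · apply le_of_eq
      rw [Finset.prod_const]
      congr 1
      · rw [sum_sign]; norm_num [show (-1 : SignType) ≠ 0 by decide]
      · simp

open scoped Classical in
theorem count1 {n L M : ℕ} (u : Fin n) :
    (((obFin n).filter (fun G => Bad1 L M G u)).card : ℝ) * (1 / 12) ^ M
      ≤ fOB (n - 1) * Fintype.card (KL n L × KL n L) * (2 ^ n * (7 / 8) ^ (20 * M)) := by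
  apply one_del (K := KL n L × KL n L) u _ (Finset.filter_subset _ _)
    (fun H k w r => if w ∈ Wset H k.1.1 then (if r ≠ 0 then 1 / 12 else 1)
      else if pred H k.2.1 w = 0 then 1 else if r = 0 ∨ r = pred H k.2.1 w then 1 else 0)
    (by intros; split_ifs <;> norm_num) _ _ (by positivity)
  intro G hGA
  obtain ⟨hGm, Q, P, hQ, hP, hQu, hcP, hW, hPQ, hWu⟩ := Finset.mem_filter.1 hGA
  clear hGA
  have hG := mem_obFin.1 hGm
  have hQu' : ∀ p ∈ Q, p.1 ∉ ({u} : Finset (Fin n)) := fun p hp => by simpa using hQu p hp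
  have hPu' : ∀ p ∈ P, p.1 ∉ ({u} : Finset (Fin n)) := fun p hp => by simpa using (hcP p hp).2.2
  refine ⟨(⟨Q, hQ⟩, ⟨P, hP⟩), ?_, ?_⟩
  · dsimp only
    have h1 : ∀ w, (if w ∈ (Wset G Q).filter (fun w => G u w ≠ 0) then (1 / 12 : ℝ) else 1) ≤
        (if w ∈ Wset (del {u} G) Q then (if G u w ≠ 0 then 1 / 12 else 1)
      else if pred (del {u} G) P w = 0 then 1
      else if G u w = 0 ∨ G u w = pred (del {u} G) P w then 1 else 0) := by
      intro w
      by_cases hw : w = u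
      · subst hw
        simp [hG.2.1]
      · have hw' : w ∉ ({u} : Finset (Fin n)) := by simpa using hw
        simp only [mem_Wset, pred_del hw' hQu', pred_del hw' hPu', Finset.mem_filter]
        by_cases h0 : pred G Q w = 0
        · simp [h0]
        · simp only [h0, false_and, if_false]
          by_cases h1 : pred G P w = 0
          · simp [h1]
          · by_cases h2 : G u w = 0
            · simp [h2]
            · simp [pred_correct hG hcP h1 h2]
    calc (1 / 12 : ℝ) ^ M ≤ (1 / 12 : ℝ) ^ ((Wset G Q).filter (fun w => G u w ≠ 0)).card :=
          pow_le_pow_of_le_one (by norm_num) (by norm_num) hWu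
      _ = _ := (prod_ite_pow _ _).symm
      _ ≤ _ := Finset.prod_le_prod (fun w _ => by split_ifs <;> norm_num) (fun w _ => h1 w)
  · dsimp only
    have hsub1 : Wset G Q ⊆ Wset (del {u} G) Q := by
      intro w hw
      by_cases h : w = u
      · exact mem_Wset.2 (pred_del_mem (by simpa using h))
      · rw [mem_Wset, pred_del (by simpa using h) hQu']; exact mem_Wset.1 hw
    have hsub2 : Wset (del {u} G) P \ Wset (del {u} G) Q ⊆ Wset G P := by
      intro w hw
      obtain ⟨hw1, hw2⟩ := Finset.mem_sdiff.1 hw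
      by_cases h : w = u
      · exact absurd (mem_Wset.2 (pred_del_mem (by simpa using h))) hw2
      · rw [mem_Wset, pred_del (by simpa using h) hPu'] at hw1; exact mem_Wset.2 hw1
    set a := (Wset (del {u} G) Q).card
    set t := (Wset (del {u} G) P \ Wset (del {u} G) Q).card
    have hta : t ≤ a := (Finset.card_le_card hsub2).trans (hPQ.trans (Finset.card_le_card hsub1))
    have ha : 20 * M ≤ a := hW.trans (Finset.card_le_card hsub1)
    calc _ ≤ ∏ w : Fin n, ((2 : ℝ) * (if w ∈ Wset (del {u} G) Q then 7 / 12 else 1) *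
          (if w ∈ Wset (del {u} G) P \ Wset (del {u} G) Q then 3 / 2 else 1)) := by
            apply Finset.prod_le_prod
            · intro w _
              exact Finset.sum_nonneg (fun r _ => by split_ifs <;> norm_num)
            · intro w _
              rw [sum_sign]
              simp only [Finset.mem_sdiff]
              by_cases h1 : w ∈ Wset (del {u} G) Q
              · simp only [h1, if_true]
                norm_num [show (-1 : SignType) ≠ 0 by decide]
              · simp only [h1, if_false]
                simp only [mem_Wset]
                by_cases h2 : pred (del {u} G) P w = 0
                · simp [h2]; norm_num
                · simp only [h2, if_false]
                  generalize pred (del {u} G) P w = s at h2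
                  fin_cases s
                  · exact absurd rfl h2
                  · norm_num [show (-1 : SignType) ≠ 0 by decide]
                  · norm_num [show (-1 : SignType) ≠ 0 by decide]
      _ = 2 ^ n * (7 / 12) ^ a * (3 / 2) ^ t := by
            rw [Finset.prod_mul_distrib, Finset.prod_mul_distrib, prod_ite_pow, prod_ite_pow]
            simp
            rfl
      _ ≤ 2 ^ n * (7 / 12) ^ a * (3 / 2) ^ a := by
            gcongr
            norm_num
      _ = 2 ^ n * (7 / 8) ^ a := by
            rw [mul_assoc, ← mul_pow]; norm_num
      _ ≤ 2 ^ n * (7 / 8) ^ (20 * M) := by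
            gcongr 2 ^ n * ?_
            exact pow_le_pow_of_le_one (by norm_num) (by norm_num) ha
open scoped Classical in
theorem count2 {n L M : ℕ} (u : Fin n) :
    (((obFin n).filter (fun G => Bad2 L M G u)).card : ℝ) * 1
      ≤ fOB (n - 1) * Fintype.card (KL n L × KL n L) *
        (2 ^ n * (3 / 4) ^ (20 * M) * (3 / 2)) := by
  apply one_del (K := KL n L × KL n L) u _ (Finset.filter_subset _ _)
    (fun H k w r => if pred H k.1.1 w * pred H k.2.1 w = -1 then (if r = 0 then 1 else 0)
      else if pred H k.1.1 w = 0 then 1 else if r = 0 ∨ r = pred H k.1.1 w then 1 else 0)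
    (by intros; split_ifs <;> norm_num) _ _ (by positivity)
  intro G hGA
  obtain ⟨hGm, Q, P, hQ, hP, hcQ, hcP, hW, hD⟩ := Finset.mem_filter.1 hGA
  clear hGA
  have hG := mem_obFin.1 hGm
  have hQu' : ∀ p ∈ Q, p.1 ∉ ({u} : Finset (Fin n)) := fun p hp => by simpa using (hcQ p hp).2.2
  have hPu' : ∀ p ∈ P, p.1 ∉ ({u} : Finset (Fin n)) := fun p hp => by simpa using (hcP p hp).2.2
  refine ⟨(⟨Q, hQ⟩, ⟨P, hP⟩), ?_, ?_⟩
  · dsimp only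
    apply le_of_eq
    symm
    apply Finset.prod_eq_one
    intro w _
    by_cases hw : w = u
    · subst hw
      simp [hG.2.1]
    · have hw' : w ∉ ({u} : Finset (Fin n)) := by simpa using hw
      simp only [pred_del hw' hQu', pred_del hw' hPu']
      by_cases h2 : G u w = 0
      · simp [h2]
      have h3 := fun h1 => pred_correct hG hcQ h1 h2
      have h4 := fun h1 => pred_correct hG hcP h1 h2
      generalize pred G Q w = s at *
      generalize pred G P w = s' at *
      generalize G u w = r at *
      have h5 : ¬ (s * s' = -1) := by
        clear hcQ hcP hW hD
        revert r s s'; decide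
      simp only [h5, if_false]
      by_cases h1 : s = 0
      · simp [h1]
      · simp [h3 h1]
  · dsimp only
    have hsub1 : Wset (del {u} G) Q ⊆ insert u (Wset G Q) := by
      intro w hw
      by_cases h : w = u
      · simp [h]
      · rw [mem_Wset, pred_del (by simpa using h) hQu'] at hw
        exact Finset.mem_insert_of_mem (mem_Wset.2 hw)
    set D := Finset.univ.filter (fun w => pred (del {u} G) Q w * pred (del {u} G) P w = -1) with hDd
    have hsub2 : Finset.univ.filter (fun w => pred G Q w * pred G P w = -1) ⊆ insert u D := by
      intro w hw
      by_cases h : w = u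
      · simp [h]
      · apply Finset.mem_insert_of_mem
        rw [Finset.mem_filter] at hw ⊢
        rw [pred_del (by simpa using h) hQu', pred_del (by simpa using h) hPu']
        exact hw
    have hDc : 20 * M ≤ D.card := by
      have := Finset.card_le_card hsub2
      have := Finset.card_insert_le u D
      omega
    have hWc : (Wset (del {u} G) Q).card ≤ 20 * M + 1 := by
      have := Finset.card_le_card hsub1
      have := Finset.card_insert_le u (Wset G Q)
      omega
    calc _ ≤ ∏ w : Fin n, ((2 : ℝ) * (if w ∈ D then 1 / 2 else 1) *
          (if w ∈ Wset (del {u} G) Q then 3 / 2 else 1)) := by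
            apply Finset.prod_le_prod
            · intro w _
              exact Finset.sum_nonneg (fun r _ => by split_ifs <;> norm_num)
            · intro w _
              rw [sum_sign]
              simp only [hDd, Finset.mem_filter, Finset.mem_univ, true_and, mem_Wset]
              generalize pred (del {u} G) Q w = s
              generalize pred (del {u} G) P w = s'
              by_cases h1 : s * s' = -1
              · have h0 : s ≠ 0 := by revert s s'; decide
                simp only [h1, h0, if_true, if_false]
                norm_num [show (-1 : SignType) ≠ 0 by decide]
              · simp only [h1, if_false]
                by_cases h2 : s = 0
                · simp [h2]; norm_num
                · simp only [h2, if_false]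
                  clear h1
                  fin_cases s
                  · exact absurd rfl h2
                  · norm_num [show (-1 : SignType) ≠ 0 by decide]
                  · norm_num [show (-1 : SignType) ≠ 0 by decide]
      _ = 2 ^ n * (1 / 2) ^ D.card * (3 / 2) ^ (Wset (del {u} G) Q).card := by
            rw [Finset.prod_mul_distrib, Finset.prod_mul_distrib, prod_ite_pow, prod_ite_pow]
            simp
      _ ≤ 2 ^ n * (1 / 2) ^ (20 * M) * (3 / 2) ^ (20 * M + 1) := by
            have h1 : (1 / 2 : ℝ) ^ D.card ≤ (1 / 2) ^ (20 * M) :=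
              pow_le_pow_of_le_one (by norm_num) (by norm_num) hDc
            have h2 : (3 / 2 : ℝ) ^ (Wset (del {u} G) Q).card ≤ (3 / 2) ^ (20 * M + 1) :=
              pow_le_pow_right₀ (by norm_num) hWc
            gcongr
      _ = 2 ^ n * (3 / 4) ^ (20 * M) * (3 / 2) := by
            rw [pow_succ, show (3 / 4 : ℝ) = 1 / 2 * (3 / 2) by norm_num, mul_pow]
            ring

def ok3 (s s' t : SignType) (r : SignType × SignType) : Bool :=
  (s = 0 ∨ r.1 = 0 ∨ r.1 = s) ∧ (s' = 0 ∨ r.2 = 0 ∨ r.2 = s') ∧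
    (t = 0 ∨ s * s' ≠ t ∨ r.1 = 0 ∨ r.2 = 0)

theorem ok3_card : ∀ s s' t : SignType, t ≠ 0 →
    (Finset.univ.filter (fun r => ok3 s s' t r = true)).card ≤
      if s * s' = t then 3 else if s = 0 ∨ s' = 0 then 9 else 4 := by decide

open scoped Classical in
theorem count3 {n L M : ℕ} (u v : Fin n) (huv : u ≠ v) :
    (((obFin n).filter (fun G => Bad3 L M G u v)).card : ℝ) * 1
      ≤ fOB (n - 2) * Fintype.card (KL n L × KL n L × SignType) *
        (4 ^ n * (3 / 4) ^ (160 * M) * (9 / 4) ^ (40 * M + 2)) := by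
  apply two_del (K := KL n L × KL n L × SignType) u v huv _ (Finset.filter_subset _ _)
    (fun H k w r => if ok3 (pred H k.1.1 w) (pred H k.2.1.1 w) k.2.2 r = true then 1 else 0)
    (by intros; split_ifs <;> norm_num) _ _ (by positivity)
  intro G hGA
  obtain ⟨hGm, Q, P, t, hQ, hP, hcQ, hcP, hWQ, hWP, ht, hD, hDuv⟩ := Finset.mem_filter.1 hGA
  clear hGA
  have hG := mem_obFin.1 hGm
  have hQu' : ∀ p ∈ Q, p.1 ∉ ({u, v} : Finset (Fin n)) := fun p hp => by
    simpa using ⟨cert_ne hG hcQ p hp, (hcQ p hp).2.2⟩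
  have hPu' : ∀ p ∈ P, p.1 ∉ ({u, v} : Finset (Fin n)) := fun p hp => by
    simpa using ⟨(hcP p hp).2.2, cert_ne hG hcP p hp⟩
  refine ⟨(⟨Q, hQ⟩, ⟨P, hP⟩, t), ?_, ?_⟩
  · dsimp only
    apply le_of_eq
    symm
    apply Finset.prod_eq_one
    intro w _
    apply if_pos
    by_cases hw : w ∈ ({u, v} : Finset (Fin n))
    · rw [pred_del_mem hw, pred_del_mem hw]
      simp [ok3, ht.symm]
    · rw [pred_del hw hQu', pred_del hw hPu']
      have h3 := fun h1 h2 => pred_correct (w := w) hG hcQ h1 h2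
      have h4 := fun h1 h2 => pred_correct (w := w) hG hcP h1 h2
      have h5 := hDuv w
      simp only [ok3, decide_eq_true_eq]
      refine ⟨?_, ?_, ?_⟩
      · by_cases a : pred G Q w = 0
        · exact Or.inl a
        · by_cases b : G u w = 0
          · exact Or.inr (Or.inl b)
          · exact Or.inr (Or.inr (h3 a b))
      · by_cases a : pred G P w = 0
        · exact Or.inl a
        · by_cases b : G v w = 0
          · exact Or.inr (Or.inl b)
          · exact Or.inr (Or.inr (h4 a b))
      · by_cases a : pred G Q w * pred G P w = t
        · exact Or.inr (Or.inr (h5 a))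
        · exact Or.inr (Or.inl a)
  · dsimp only
    set D := Finset.univ.filter
      (fun w => pred (del {u, v} G) Q w * pred (del {u, v} G) P w = t) with hDd
    have hsub2 : Finset.univ.filter (fun w => pred G Q w * pred G P w = t) ⊆ D ∪ {u, v} := by
      intro w hw
      rw [Finset.mem_union]
      by_cases h : w ∈ ({u, v} : Finset (Fin n))
      · exact Or.inr h
      · left
        rw [Finset.mem_filter] at hw ⊢
        rw [pred_del h hQu', pred_del h hPu']
        exact hw
    set W := Wset (del {u, v} G) Q ∪ Wset (del {u, v} G) P with hWd
    have hsub1 : W ⊆ (Wset G Q ∪ Wset G P) ∪ {u, v} := by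
      intro w hw
      rw [Finset.mem_union]
      by_cases h : w ∈ ({u, v} : Finset (Fin n))
      · exact Or.inr h
      · left
        rw [Finset.mem_union, mem_Wset, mem_Wset, pred_del h hQu', pred_del h hPu'] at hw
        rw [Finset.mem_union, mem_Wset, mem_Wset]
        exact hw
    have h2c : ({u, v} : Finset (Fin n)).card = 2 := Finset.card_pair huv
    have hDc : 160 * M ≤ D.card := by
      have := Finset.card_le_card hsub2
      have := Finset.card_union_le D {u, v}
      omega
    have hWc : W.card ≤ 40 * M + 2 := by
      have := Finset.card_le_card hsub1
      have := Finset.card_union_le (Wset G Q ∪ Wset G P) {u, v}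
      have := Finset.card_union_le (Wset G Q) (Wset G P)
      omega
    calc _ ≤ ∏ w : Fin n, ((4 : ℝ) * (if w ∈ D then 3 / 4 else 1) *
          (if w ∈ W then 9 / 4 else 1)) := by
            apply Finset.prod_le_prod
            · intro w _
              exact Finset.sum_nonneg (fun r _ => by split_ifs <;> norm_num)
            · intro w _
              rw [Finset.sum_boole]
              simp only [hDd, hWd, Finset.mem_filter, Finset.mem_univ, true_and, mem_Wset,
                Finset.mem_union]
              generalize pred (del {u, v} G) Q w = s
              generalize pred (del {u, v} G) P w = s'
              have hc := ok3_card s s' t ht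
              have hc' : ((Finset.univ.filter (fun r => ok3 s s' t r = true)).card : ℝ) ≤
                ((if s * s' = t then 3 else if s = 0 ∨ s' = 0 then 9 else 4 : ℕ) : ℝ) := by
                exact_mod_cast hc
              refine hc'.trans ?_
              by_cases h1 : s * s' = t
              · have h0 : ¬ (s = 0 ∨ s' = 0) := by
                  rintro (h | h)
                  · rw [h, zero_mul] at h1; exact ht h1.symm
                  · rw [h, mul_zero] at h1; exact ht h1.symm
                simp only [h1, h0, if_true, if_false]
                norm_num
              · simp only [h1, if_false]
                split_ifs <;> norm_num
      _ = 4 ^ n * (3 / 4) ^ D.card * (9 / 4) ^ W.card := by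
            rw [Finset.prod_mul_distrib, Finset.prod_mul_distrib, prod_ite_pow, prod_ite_pow]
            simp
      _ ≤ 4 ^ n * (3 / 4) ^ (160 * M) * (9 / 4) ^ (40 * M + 2) := by
            have h1 : (3 / 4 : ℝ) ^ D.card ≤ (3 / 4) ^ (160 * M) :=
              pow_le_pow_of_le_one (by norm_num) (by norm_num) hDc
            have h2 : (9 / 4 : ℝ) ^ W.card ≤ (9 / 4) ^ (40 * M + 2) :=
              pow_le_pow_right₀ (by norm_num) hWc
            gcongr
open scoped Classical in
def cnt {n : ℕ} (p : Fin n → Prop) : ℕ := (Finset.univ.filter p).card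

theorem cnt_mono {n : ℕ} {p q : Fin n → Prop} (h : ∀ w, p w → q w) : cnt p ≤ cnt q := by
  classical
  apply Finset.card_le_card
  intro w hw
  simp only [Finset.mem_filter, Finset.mem_univ, true_and] at hw ⊢
  exact h w hw

theorem cnt_or {n : ℕ} (p q : Fin n → Prop) : cnt (fun w => p w ∨ q w) ≤ cnt p + cnt q := by
  classical
  refine (Finset.card_le_card (t := Finset.univ.filter p ∪ Finset.univ.filter q) ?_).trans
    ((Finset.card_union_le _ _).trans (le_of_eq ?_))
  · intro w hw
    simpa using hw
  · unfold cnt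
    congr!

theorem cnt_or_le {n : ℕ} {p q : Fin n → Prop} {a b : ℕ} (hp : cnt p ≤ a) (hq : cnt q ≤ b) :
    cnt (fun w => p w ∨ q w) ≤ a + b := (cnt_or p q).trans (add_le_add hp hq)

theorem exists_of_cnt_lt {n : ℕ} {p : Fin n → Prop} (h : cnt p < n) : ∃ w, ¬ p w := by
  classical
  by_contra hc
  push Not at hc
  have : cnt p = n := by
    unfold cnt
    rw [Finset.filter_true_of_mem (fun w _ => hc w)]
    simp
  omega

theorem sgn_aux1 : ∀ a a' b b' r : SignType, a ≠ 0 → b ≠ 0 → a' ≠ 0 → b' ≠ 0 → r ≠ 0 →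
    a * a' ≠ -1 → b * b' ≠ -1 → a' * b' ≠ -r → a * b = r := by decide

theorem sgn_aux2 : ∀ a b c r s : SignType, r ≠ 0 → s ≠ 0 → a * b = r → c * b = s →
    a * c = r * s := by decide

theorem sgn_aux3' : ∀ a b c : SignType, a * c ≠ 0 → b * c ≠ 0 → a * b = a * c * (b * c) := by
  decide

theorem sgn_aux3 (a b c x y r : SignType) (h1 : a * c = x) (h2 : b * c = y) (h3 : a * b = r)
    (hx : x ≠ 0) (hy : y ≠ 0) : r = x * y := by
  subst h1 h2 h3
  exact sgn_aux3' a b c hx hy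

theorem sgn_aux4 : ∀ a b : SignType, a ≠ 0 → b ≠ 0 → a * b ≠ 1 → a * b ≠ -1 → False := by decide

theorem sgn_aux5 : ∀ a b r : SignType, a * r * b ≠ -1 → r ≠ 0 → a * b ≠ 0 → a * b ≠ -r := by decide

theorem balanced_of_good {n L M : ℕ} (hL : n < L * M) (hn : 1400 * M + 5 < n)
    (G : Fin n → Fin n → SignType) (hG : IsOB G) (h0 : ∀ v, ¬ Bad0 L G v)
    (h1 : ∀ u, ¬ Bad1 L M G u) (h2 : ∀ u, ¬ Bad2 L M G u)
    (h3 : ∀ u v, u ≠ v → ¬ Bad3 L M G u v) :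
    ∃ τ : Fin n → SignType, (∀ u, τ u ≠ 0) ∧ ∀ u w, G u w ≠ 0 → G u w = τ u * τ w := by
  classical
  choose P hcert hcard hsmall using fun v x => exists_cert hL G v x
  have hself : ∀ v x, Cert G v v (P v x) := fun v x p hp =>
    ⟨(hcert v x p hp).1, (hcert v x p hp).2.1, cert_ne hG (hcert v x) p hp⟩
  have v0 : Fin n := ⟨0, by omega⟩
  have hW : ∀ v x, (Wset G (P v x)).card ≤ 20 * M := by
    obtain ⟨⟨v, x⟩, -, hmax⟩ := Finset.exists_max_image (Finset.univ : Finset (Fin n × Fin n))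
      (fun p => (Wset G (P p.1 p.2)).card) ⟨(v0, v0), Finset.mem_univ _⟩
    suffices h : (Wset G (P v x)).card ≤ 20 * M from
      fun v' x' => (hmax (v', x') (Finset.mem_univ _)).trans h
    by_contra hlt
    push Not at hlt
    have hdeg := h0 v
    unfold Bad0 at hdeg
    have hlt2 : (insert x ((P v x).image Prod.fst)).card <
        (Finset.univ.filter (fun w => G v w ≠ 0)).card := by
      have a := Finset.card_insert_le x ((P v x).image Prod.fst)
      have b := Finset.card_image_le (s := P v x) (f := Prod.fst)
      have c := hcard v x
      omega
    obtain ⟨u, hu, hu'⟩ := Finset.exists_mem_notMem_of_card_lt_card hlt2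
    simp only [Finset.mem_filter, Finset.mem_univ, true_and] at hu
    rw [Finset.mem_insert, not_or] at hu'
    refine h1 u ⟨P v x, P u u, hcard _ _, hcard _ _, ?_, hself u u, hlt.le,
      hmax (u, u) (Finset.mem_univ _), ?_⟩
    · rintro p hp rfl
      exact hu'.2 (Finset.mem_image_of_mem _ hp)
    · convert hsmall v x u hu'.1 hu
  have hW' : ∀ v x, cnt (fun w => pred G (P v x) w = 0) ≤ 20 * M := by
    intro v x
    have := hW v x
    unfold Wset at this
    unfold cnt
    convert this
  have hA : ∀ u x, cnt (fun w => pred G (P u u) w * pred G (P u x) w = -1) ≤ 20 * M := by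
    intro u x
    by_contra hlt
    refine h2 u ⟨P u u, P u x, hcard _ _, hcard _ _, hself u u, hself u x, hW u u, ?_⟩
    unfold cnt at hlt
    push Not at hlt
    convert Nat.succ_le_of_lt hlt
  have hB : ∀ u v, u ≠ v → ∀ t : SignType, t ≠ 0 →
      cnt (fun w => pred G (P u v) w * pred G (P v u) w = t) ≤ 160 * M + 1 ∨
      ∃ w, pred G (P u v) w * pred G (P v u) w = t ∧ G u w ≠ 0 ∧ G v w ≠ 0 := by
    intro u v huv t ht
    by_contra hc
    push Not at hc
    obtain ⟨hc1, hc2⟩ := hc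
    refine h3 u v huv ⟨P u v, P v u, t, hcard _ _, hcard _ _, hcert u v, hcert v u, hW _ _,
      hW _ _, ht, ?_, ?_⟩
    · unfold cnt at hc1
      convert Nat.succ_le_of_lt hc1
    · intro w hw
      by_cases h : G u w = 0
      · exact Or.inl h
      · exact Or.inr (hc2 w hw h)
  have hE : ∀ u v, G u v ≠ 0 →
      cnt (fun w => ¬ (pred G (P u u) w * pred G (P v v) w = G u v)) ≤ 280 * M + 1 := by
    intro u v huv
    have hne : u ≠ v := by rintro rfl; exact huv (hG.2.1 u)
    have hneg : - G u v ≠ 0 := by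
      generalize G u v = r at huv
      revert r; decide
    have hD : cnt (fun w => pred G (P u v) w * pred G (P v u) w = - G u v) ≤ 160 * M + 1 := by
      rcases hB u v hne _ hneg with h | ⟨w, hw, hu, hv⟩
      · exact h
      · exfalso
        have hp : pred G (P u v) w ≠ 0 := by
          intro h; rw [h, zero_mul] at hw; exact hneg hw.symm
        have hp' : pred G (P v u) w ≠ 0 := by
          intro h; rw [h, mul_zero] at hw; exact hneg hw.symm
        rw [← pred_correct hG (hcert u v) hp hu, ← pred_correct hG (hcert v u) hp' hv] at hw
        have := hG.2.2 u v w
        generalize G u v = r at *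
        generalize G u w = s at *
        generalize G v w = s' at *
        clear hp hp' hneg hB h3
        revert r s s'; decide
    have := cnt_or_le (hW' u u) (cnt_or_le (hW' v v) (cnt_or_le (hW' u v) (cnt_or_le (hW' v u)
      (cnt_or_le (hA u v) (cnt_or_le (hA v u) hD)))))
    refine (cnt_mono ?_).trans (this.trans (by omega))
    intro w hw
    by_contra hc
    push Not at hc
    obtain ⟨a, b, c, d, e, f, g⟩ := hc
    exact hw (sgn_aux1 _ _ _ _ _ a b c d huv e f g)
  have hC : ∀ u v, u ≠ v → ∃ w, G u w ≠ 0 ∧ G v w ≠ 0 := by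
    intro u v huv
    rcases hB u v huv 1 (by decide) with hp | ⟨w, _, h, h'⟩
    · rcases hB u v huv (-1) (by decide) with hm | ⟨w, _, h, h'⟩
      · exfalso
        have := cnt_or_le (hW' u v) (cnt_or_le (hW' v u) (cnt_or_le hp hm))
        obtain ⟨w, hw⟩ := exists_of_cnt_lt (lt_of_le_of_lt this (by omega))
        push Not at hw
        exact sgn_aux4 _ _ hw.1 hw.2.1 hw.2.2.1 hw.2.2.2
      · exact ⟨w, h, h'⟩
    · exact ⟨w, h, h'⟩
  have hT : ∀ u, ∃ t : SignType, t ≠ 0 ∧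
      cnt (fun w => ¬ (pred G (P u u) w * pred G (P v0 v0) w = t)) ≤ 560 * M + 2 := by
    intro u
    by_cases hu : u = v0
    · refine ⟨1, by decide, (cnt_mono ?_).trans ((hW' u u).trans (by omega))⟩
      intro w hw
      rw [hu] at hw ⊢
      generalize pred G (P v0 v0) w = s at hw
      revert s; decide
    · obtain ⟨z, hz, hz'⟩ := hC u v0 hu
      refine ⟨G u z * G v0 z, mul_ne_zero hz hz', ?_⟩
      have := cnt_or_le (hE u z hz) (hE v0 z hz')
      refine (cnt_mono ?_).trans (this.trans (by omega))
      intro w hw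
      by_contra hc
      push Not at hc
      exact hw (sgn_aux2 _ _ _ _ _ hz hz' hc.1 hc.2)
  choose τ hτ hτc using hT
  refine ⟨τ, hτ, ?_⟩
  intro u v huv
  have := cnt_or_le (hτc u) (cnt_or_le (hτc v) (hE u v huv))
  obtain ⟨w, hw⟩ := exists_of_cnt_lt (lt_of_le_of_lt this (by omega))
  push Not at hw
  exact sgn_aux3 _ _ _ _ _ _ hw.1 hw.2.1 hw.2.2 (hτ u) (hτ v)

def Bal {n : ℕ} (G : Fin n → Fin n → SignType) : Prop :=
  ∃ τ : Fin n → SignType, (∀ u, τ u ≠ 0) ∧ ∀ u w, G u w ≠ 0 → G u w = τ u * τ w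

open scoped Classical in
theorem card_bal (n : ℕ) : ((obFin (n + 1)).filter Bal).card ≤ 2 ^ n * 2 ^ ((n + 1).choose 2) := by
  let E := {p : Sym2 (Fin (n + 1)) // ¬ p.IsDiag}
  let sg : Bool → SignType := fun b => if b then 1 else -1
  let Φ : (Fin n → Bool) × (E → Bool) → Fin (n + 1) → Fin (n + 1) → SignType := fun q x y =>
    if h : ¬ (s(x, y) : Sym2 (Fin (n + 1))).IsDiag then
      if q.2 ⟨s(x, y), h⟩ then
        (Fin.cons 1 (fun i => sg (q.1 i)) : Fin (n + 1) → SignType) x *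
        (Fin.cons 1 (fun i => sg (q.1 i)) : Fin (n + 1) → SignType) y else 0
    else 0
  have hsub : (obFin (n + 1)).filter Bal ⊆ Finset.univ.image Φ := by
    intro G hG
    obtain ⟨hG, τ, hτ, hb⟩ := Finset.mem_filter.1 hG
    have hG := mem_obFin.1 hG
    rw [Finset.mem_image]
    refine ⟨(fun i => decide (τ i.succ * τ 0 = 1),
      fun p => decide (p.1.lift ⟨fun x y => G x y ≠ 0, fun x y => by simp only [hG.1 x y]⟩)),
      Finset.mem_univ _, ?_⟩
    have hc : (Fin.cons 1 (fun i : Fin n => sg (decide (τ i.succ * τ 0 = 1))) :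
        Fin (n + 1) → SignType) = fun x => τ x * τ 0 := by
      funext x
      refine Fin.cases ?_ (fun i => ?_) x
      · have := hτ 0
        simp only [Fin.cons_zero]
        generalize τ 0 = s at this
        revert s; decide
      · simp only [Fin.cons_succ, sg, decide_eq_true_eq]
        have a := hτ 0
        have b := hτ i.succ
        generalize τ 0 = s at a
        generalize τ i.succ = s' at b
        revert s s'; decide
    funext x y
    simp only [Φ, hc]
    by_cases hxy : x = y
    · subst hxy
      simp [hG.2.1]
    · rw [dif_pos (by simpa using hxy)]
      by_cases h'' : G x y = 0
      · simp [h'']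
      · rw [if_pos (by rw [decide_eq_true_eq]; exact h''), hb x y h'']
        have a := hτ 0
        generalize τ 0 = s at a
        generalize τ x = s1
        generalize τ y = s2
        revert s s1 s2; decide
  refine (Finset.card_le_card hsub).trans (Finset.card_image_le.trans ?_)
  rw [Finset.card_univ, Fintype.card_prod, Fintype.card_fun, Fintype.card_fun, Fintype.card_bool,
    Fintype.card_fin]
  have : Fintype.card E = (n + 1).choose 2 := by
    have := Sym2.card_subtype_not_diag (α := Fin (n + 1))
    rw [Fintype.card_fin] at this
    convert this
  rw [this]
open scoped Classical in
theorem f_union {n L M : ℕ} (hL : n < L * M) (hn : 1400 * M + 5 < n) :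
    fOB n ≤ ((obFin n).filter Bal).card
      + ∑ v, ((obFin n).filter (fun G => Bad0 L G v)).card
      + ∑ v, ((obFin n).filter (fun G => Bad1 L M G v)).card
      + ∑ v, ((obFin n).filter (fun G => Bad2 L M G v)).card
      + ∑ p : Fin n × Fin n, ((obFin n).filter (fun G => p.1 ≠ p.2 ∧ Bad3 L M G p.1 p.2)).card := by
  have hsub : obFin n ⊆ ((((obFin n).filter Bal)
      ∪ (Finset.univ.biUnion fun v => (obFin n).filter (fun G => Bad0 L G v)))
      ∪ (Finset.univ.biUnion fun v => (obFin n).filter (fun G => Bad1 L M G v)))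
      ∪ (Finset.univ.biUnion fun v => (obFin n).filter (fun G => Bad2 L M G v))
      ∪ (Finset.univ.biUnion fun p : Fin n × Fin n =>
          (obFin n).filter (fun G => p.1 ≠ p.2 ∧ Bad3 L M G p.1 p.2)) := by
    intro G hG
    by_contra hc
    simp only [Finset.mem_union, Finset.mem_biUnion, Finset.mem_univ, true_and, Finset.mem_filter,
      hG, not_or, not_exists, not_and] at hc
    obtain ⟨⟨⟨⟨hb, h0⟩, h1⟩, h2⟩, h3⟩ := hc
    exact hb (balanced_of_good hL hn G (mem_obFin.1 hG) h0 h1 h2 (fun u v => h3 (u, v)))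
  refine (Finset.card_le_card hsub).trans ?_
  refine (Finset.card_union_le _ _).trans (add_le_add ?_ Finset.card_biUnion_le)
  refine (Finset.card_union_le _ _).trans (add_le_add ?_ Finset.card_biUnion_le)
  refine (Finset.card_union_le _ _).trans (add_le_add ?_ Finset.card_biUnion_le)
  refine (Finset.card_union_le _ _).trans (add_le_add le_rfl Finset.card_biUnion_le)

theorem card_KK (n L : ℕ) : (Fintype.card (KL n L × KL n L) : ℝ) ≤ (3 * n + 1) ^ (2 * L) := by
  rw [Fintype.card_prod, two_mul, pow_add]
  have : (Fintype.card (KL n L) : ℝ) ≤ (3 * n + 1) ^ L := by exact_mod_cast card_KL n L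
  push_cast
  gcongr

theorem f_rec {n L M : ℕ} (hL : n < L * M) (hn : 1400 * M + 5 < n) (s : ℝ) (hs : 3 / 5 ≤ s)
    (hsM : (21 / 25 : ℝ) ^ M ≤ s ^ n) :
    (fOB n : ℝ) ≤ 2 ^ (n - 1) * 2 ^ (n.choose 2) +
      s ^ n * (16 * n ^ 2 * (3 * n + 1) ^ (2 * L) * 10 ^ (L + 2)) *
        (fOB (n - 1) * 2 ^ n + fOB (n - 2) * 4 ^ n) := by
  classical
  have hs0 : 0 ≤ s := by linarith
  set p : ℝ := (3 * n + 1) ^ (2 * L) with hp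
  set T : ℝ := 10 ^ (L + 2) with hT
  have hp1 : 1 ≤ p := one_le_pow₀ (by have : (0 : ℝ) ≤ n := Nat.cast_nonneg n
                                      linarith)
  have hT1 : 1 ≤ T := one_le_pow₀ (by norm_num)
  have hpT : p ≤ p * T := le_mul_of_one_le_right (by linarith) hT1
  have hTp : T ≤ p * T := le_mul_of_one_le_left (by linarith) hp1
  have hn1 : (1 : ℝ) ≤ n := by
    have : 1 ≤ n := by omega
    exact_mod_cast this
  have hsn : 0 ≤ s ^ n := by positivity
  set f1 : ℝ := ((fOB (n - 1) : ℕ) : ℝ) with hf1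
  set f2 : ℝ := ((fOB (n - 2) : ℕ) : ℝ) with hf2
  have hf1' : 0 ≤ f1 := Nat.cast_nonneg _
  have hf2' : 0 ≤ f2 := Nat.cast_nonneg _
  have b0 : ∀ v : Fin n, (((obFin n).filter (fun G => Bad0 L G v)).card : ℝ) ≤
      f1 * 2 ^ n * s ^ n * (p * T) := by
    intro v
    have h := count0 (L := L) v
    have e : (((obFin n).filter (fun G => Bad0 L G v)).card : ℝ) =
      (((obFin n).filter (fun G => Bad0 L G v)).card : ℝ) * (1 / 10) ^ (L + 2) * T := by
      rw [mul_assoc, hT, ← mul_pow]; norm_num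
    rw [e]
    calc _ ≤ f1 * 1 * (6 / 5) ^ n * T := by
          apply mul_le_mul_of_nonneg_right _ (by linarith)
          convert h
      _ ≤ f1 * 1 * (2 ^ n * s ^ n) * (p * T) := by
          have : (6 / 5 : ℝ) ^ n ≤ 2 ^ n * s ^ n := by
            rw [← mul_pow]
            exact pow_le_pow_left₀ (by norm_num) (by linarith) n
          gcongr
      _ = _ := by ring
  have b1 : ∀ v : Fin n, (((obFin n).filter (fun G => Bad1 L M G v)).card : ℝ) ≤
      f1 * 2 ^ n * s ^ n * (p * T) := by
    intro v
    have h := count1 (L := L) (M := M) v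
    have e : (((obFin n).filter (fun G => Bad1 L M G v)).card : ℝ) =
      (((obFin n).filter (fun G => Bad1 L M G v)).card : ℝ) * (1 / 12) ^ M * 12 ^ M := by
      rw [mul_assoc, ← mul_pow]; norm_num
    rw [e]
    calc _ ≤ f1 * Fintype.card (KL n L × KL n L) * (2 ^ n * (7 / 8) ^ (20 * M)) * 12 ^ M := by
          apply mul_le_mul_of_nonneg_right _ (by positivity)
          convert h
      _ = f1 * Fintype.card (KL n L × KL n L) * 2 ^ n * ((7 / 8) ^ 20 * 12) ^ M := by
          rw [mul_pow, pow_mul]; ring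
      _ ≤ f1 * (p * T) * 2 ^ n * s ^ n := by
          have h1 : (Fintype.card (KL n L × KL n L) : ℝ) ≤ p * T := (card_KK n L).trans hpT
          have h2 : ((7 / 8 : ℝ) ^ 20 * 12) ^ M ≤ s ^ n :=
            (pow_le_pow_left₀ (by norm_num) (by norm_num) M).trans hsM
          gcongr
      _ = _ := by ring
  have b2 : ∀ v : Fin n, (((obFin n).filter (fun G => Bad2 L M G v)).card : ℝ) ≤
      f1 * 2 ^ n * s ^ n * (p * T) * (3 / 2) := by
    intro v
    have h := count2 (L := L) (M := M) v
    rw [mul_one] at h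
    calc _ ≤ f1 * Fintype.card (KL n L × KL n L) * (2 ^ n * (3 / 4) ^ (20 * M) * (3 / 2)) := by
          convert h
      _ = f1 * Fintype.card (KL n L × KL n L) * 2 ^ n * ((3 / 4) ^ 20) ^ M * (3 / 2) := by
          rw [pow_mul]; ring
      _ ≤ f1 * (p * T) * 2 ^ n * s ^ n * (3 / 2) := by
          have h1 : (Fintype.card (KL n L × KL n L) : ℝ) ≤ p * T := (card_KK n L).trans hpT
          have h2 : ((3 / 4 : ℝ) ^ 20) ^ M ≤ s ^ n :=
            (pow_le_pow_left₀ (by norm_num) (by norm_num) M).trans hsM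
          gcongr
      _ = _ := by ring
  have b3 : ∀ q : Fin n × Fin n,
      (((obFin n).filter (fun G => q.1 ≠ q.2 ∧ Bad3 L M G q.1 q.2)).card : ℝ) ≤
      f2 * 4 ^ n * s ^ n * (p * T) * 16 := by
    intro q
    by_cases hq : q.1 = q.2
    · simp only [hq, ne_eq, not_true_eq_false, false_and, Finset.filter_false, Finset.card_empty,
        Nat.cast_zero]
      positivity
    have h := count3 (L := L) (M := M) q.1 q.2 hq
    rw [mul_one] at h
    have hc : (Fintype.card (KL n L × KL n L × SignType) : ℝ) =
        Fintype.card (KL n L × KL n L) * 3 := by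
      have : Fintype.card SignType = 3 := by decide
      simp only [Fintype.card_prod, this]
      push_cast
      ring
    calc _ ≤ f2 * Fintype.card (KL n L × KL n L × SignType) *
            (4 ^ n * (3 / 4) ^ (160 * M) * (9 / 4) ^ (40 * M + 2)) := by
          refine le_trans (le_of_eq ?_) h
          congr 2
          ext G
          simp [hq]
      _ = f2 * Fintype.card (KL n L × KL n L) * 4 ^ n *
            ((3 / 4) ^ 160 * (9 / 4) ^ 40) ^ M * (3 * (9 / 4) ^ 2) := by
          rw [hc, mul_pow, pow_add, ← pow_mul, ← pow_mul]; ring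
      _ ≤ f2 * (p * T) * 4 ^ n * s ^ n * 16 := by
          have h1 : (Fintype.card (KL n L × KL n L) : ℝ) ≤ p * T := (card_KK n L).trans hpT
          have h2 : ((3 / 4 : ℝ) ^ 160 * (9 / 4) ^ 40) ^ M ≤ s ^ n :=
            (pow_le_pow_left₀ (by norm_num) (by norm_num) M).trans hsM
          have h3 : (3 * (9 / 4) ^ 2 : ℝ) ≤ 16 := by norm_num
          gcongr
      _ = _ := by ring
  have hbal : (((obFin n).filter Bal).card : ℝ) ≤ 2 ^ (n - 1) * 2 ^ (n.choose 2) := by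
    obtain ⟨m, rfl⟩ : ∃ m, n = m + 1 := ⟨n - 1, by omega⟩
    have := card_bal m
    rw [Nat.add_sub_cancel]
    exact_mod_cast this
  have hu : (fOB n : ℝ) ≤ _ := Nat.cast_le.2 (f_union hL hn)
  push_cast at hu
  have s0 := Finset.sum_le_card_nsmul Finset.univ _ _ (fun v _ => b0 v)
  have s1 := Finset.sum_le_card_nsmul Finset.univ _ _ (fun v _ => b1 v)
  have s2 := Finset.sum_le_card_nsmul Finset.univ _ _ (fun v _ => b2 v)
  have s3 := Finset.sum_le_card_nsmul Finset.univ _ _ (fun v _ => b3 v)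
  simp only [Finset.card_univ, Fintype.card_fin, Fintype.card_prod, nsmul_eq_mul] at s0 s1 s2 s3
  push_cast at s3
  set X := f1 * 2 ^ n * s ^ n * (p * T) with hX
  have hX0 : 0 ≤ X := by positivity
  have hfin : s ^ n * (16 * n ^ 2 * p * T) * (f1 * 2 ^ n + f2 * 4 ^ n) =
      16 * n ^ 2 * X + n * n * (f2 * 4 ^ n * s ^ n * (p * T) * 16) := by rw [hX]; ring
  have hnX : (n : ℝ) * X ≤ n ^ 2 * X := by
    rw [pow_two]
    apply mul_le_mul_of_nonneg_right _ hX0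
    nlinarith
  have hnX0 : 0 ≤ (n : ℝ) * X := by positivity
  rw [hfin]
  have e2 : (n : ℝ) * (X * (3 / 2)) = 3 / 2 * (n * X) := by ring
  linarith

open scoped Classical in
/-- The signed matrix of a colored graph. -/
def sgnOf {n : ℕ} (G : ColoredGraph n) (x y : Fin n) : SignType :=
  if G.red.Adj x y then 1 else if G.blue.Adj x y then -1 else 0

theorem sgnOf_red {n : ℕ} (G : ColoredGraph n) (x y : Fin n) :
    sgnOf G x y = 1 ↔ G.red.Adj x y := by
  unfold sgnOf
  split_ifs <;> simp_all

theorem sgnOf_blue {n : ℕ} (G : ColoredGraph n) (x y : Fin n) :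
    sgnOf G x y = -1 ↔ G.blue.Adj x y := by
  have := G.disj x y
  unfold sgnOf
  split_ifs <;> simp_all

theorem sgnOf_adj {n : ℕ} (G : ColoredGraph n) (x y : Fin n) :
    sgnOf G x y ≠ 0 ↔ G.Adj x y := by
  unfold sgnOf ColoredGraph.Adj ColoredGraph.graph
  split_ifs <;> simp_all

theorem sgnOf_inj {n : ℕ} : Function.Injective (sgnOf (n := n)) := by
  intro G H h
  have h1 : G.red = H.red := by
    ext x y
    rw [← sgnOf_red, ← sgnOf_red, h]
  have h2 : G.blue = H.blue := by
    ext x y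
    rw [← sgnOf_blue, ← sgnOf_blue, h]
  cases G; cases H; simp_all

theorem sgnOf_isOB {n : ℕ} (G : ColoredGraph n) (hG : G.OBTF) : IsOB (sgnOf G) := by
  refine ⟨?_, ?_, ?_⟩
  · intro x y
    have h1 := G.red.adj_comm x y
    have h2 := G.blue.adj_comm x y
    unfold sgnOf
    split_ifs <;> simp_all
  · intro x
    simp [sgnOf]
  · intro x y z h
    have a1 : sgnOf G x y ≠ 0 := by intro h0; simp [h0] at h
    have a2 : sgnOf G y z ≠ 0 := by intro h0; simp [h0] at h
    have a3 : sgnOf G x z ≠ 0 := by intro h0; simp [h0] at h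
    have := hG x y z ((sgnOf_adj ..).1 a1) ((sgnOf_adj ..).1 a2) ((sgnOf_adj ..).1 a3)
    unfold ColoredGraph.blueInd at this
    simp only [← sgnOf_blue] at this
    generalize sgnOf G x y = a at *
    generalize sgnOf G y z = b at *
    generalize sgnOf G x z = c at *
    revert this
    rw [imp_false, not_not]
    revert a b c
    decide

theorem Fnum_le (n : ℕ) : Fnum n ≤ fOB n := by
  unfold Fnum fOB
  rw [← Set.ncard_coe_finset]
  refine Set.ncard_le_ncard_of_injOn sgnOf ?_ sgnOf_inj.injOn (Finset.finite_toSet _)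
  intro G hG
  rw [Finset.mem_coe, mem_obFin]
  exact sgnOf_isOB G hG

/-- The main term. -/
def aa (n : ℕ) : ℝ := (2 : ℝ) ^ (n * (n + 1) / 2 - 1)

theorem aa_pos (n : ℕ) : 0 < aa n := by unfold aa; positivity
theorem one_le_aa (n : ℕ) : 1 ≤ aa n := by unfold aa; exact one_le_pow₀ (by norm_num)

theorem aa_eq (n : ℕ) (hn : 1 ≤ n) : (2 : ℝ) ^ (n - 1) * 2 ^ (n.choose 2) = aa n := by
  unfold aa
  rw [← pow_add]
  congr 1
  obtain ⟨m, rfl⟩ : ∃ m, n = m + 1 := ⟨n - 1, by omega⟩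
  rw [Nat.choose_two_right]
  have h1 : (m + 1) * (m + 1 + 1) = (m + 1) * (m + 1 - 1) + 2 * (m + 1) := by
    simp only [Nat.add_sub_cancel]; ring
  rw [h1]
  omega

theorem tri_even (n : ℕ) : ∃ t, n * (n + 1) = 2 * t := by
  obtain ⟨t, ht⟩ := Nat.even_mul_succ_self n
  exact ⟨t, by omega⟩

theorem aa_step (n : ℕ) (hn : 1 ≤ n) : aa n * 2 ^ (n + 1) = aa (n + 1) := by
  unfold aa
  rw [← pow_add]
  congr 1
  obtain ⟨t, ht⟩ := tri_even n
  have h1 : (n + 1) * (n + 1 + 1) = 2 * t + 2 * (n + 1) := by rw [← ht]; ring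
  have h2 : 1 ≤ t := by nlinarith
  rw [h1, ht]
  omega

theorem aa_step2 (n : ℕ) (hn : 1 ≤ n) : aa n * 4 ^ (n + 2) = 2 * aa (n + 2) := by
  rw [← aa_step (n + 1) (by omega), ← aa_step n hn]
  rw [show (4 : ℝ) = 2 ^ 2 by norm_num, ← pow_mul]
  ring

theorem poly_exp (L : ℕ) (s r : ℝ) (hs : 0 < s) (hsr : s < r) :
    ∀ᶠ n : ℕ in atTop, 6 * (s ^ n * (16 * (n : ℝ) ^ 2 * (3 * (n : ℝ) + 1) ^ (2 * L) * 10 ^ (L + 2)))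
      ≤ r ^ n := by
  have hr : 0 < r := hs.trans hsr
  obtain ⟨C, hC⟩ : ∃ C : ℝ, C = 6 * (16 * 4 ^ (2 * L) * 10 ^ (L + 2)) := ⟨_, rfl⟩
  have hCpos : 0 < C := by rw [hC]; positivity
  have ht : |s / r| < 1 := by
    rw [abs_of_pos (by positivity), div_lt_one hr]; exact hsr
  have := tendsto_pow_const_mul_const_pow_of_abs_lt_one (2 + 2 * L) ht
  have h2 := (this.eventually (gt_mem_nhds (show (0 : ℝ) < 1 / C by positivity)))
  filter_upwards [h2, eventually_ge_atTop 1] with n hn h1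
  have h1' : (1 : ℝ) ≤ n := by exact_mod_cast h1
  have h3 : (3 * (n : ℝ) + 1) ^ (2 * L) ≤ (4 * n) ^ (2 * L) := by
    gcongr; linarith
  calc 6 * (s ^ n * (16 * (n : ℝ) ^ 2 * (3 * (n : ℝ) + 1) ^ (2 * L) * 10 ^ (L + 2)))
      ≤ 6 * (s ^ n * (16 * (n : ℝ) ^ 2 * (4 * n) ^ (2 * L) * 10 ^ (L + 2))) := by gcongr
    _ = C * ((n : ℝ) ^ (2 + 2 * L) * (s / r) ^ n) * r ^ n := by
        rw [hC, div_pow, mul_pow]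
        field_simp
        rw [← pow_add]
    _ ≤ C * (1 / C) * r ^ n := by gcongr
    _ = r ^ n := by field_simp

theorem fOB_bound : ∃ r : ℝ, 0 < r ∧ r < 1 ∧ ∃ Δ : ℝ, 0 < Δ ∧ ∀ n : ℕ, 1 ≤ n →
    (fOB n : ℝ) ≤ (1 + Δ * r ^ n) * aa n := by
  obtain ⟨L, hL⟩ : ∃ L : ℕ, L = 1600 := ⟨_, rfl⟩
  obtain ⟨q, hq⟩ : ∃ q : ℝ, q = 21 / 25 := ⟨_, rfl⟩
  have hq0 : 0 < q := by rw [hq]; norm_num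
  have hq1 : q < 1 := by rw [hq]; norm_num
  have hLp : (0 : ℝ) < L := by rw [hL]; norm_num
  obtain ⟨s, hs⟩ : ∃ s : ℝ, s = q ^ (1 / (L : ℝ)) := ⟨_, rfl⟩
  have hs0 : 0 < s := by rw [hs]; positivity
  have hs1 : s < 1 := by rw [hs]; exact Real.rpow_lt_one hq0.le hq1 (by positivity)
  have hsq : q ≤ s := by
    rw [hs]
    conv_lhs => rw [← Real.rpow_one q]
    apply Real.rpow_le_rpow_of_exponent_ge hq0 hq1.le
    rw [div_le_one hLp, hL]; norm_num
  have hs35 : 3 / 5 ≤ s := le_trans (by rw [hq]; norm_num) hsq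
  have hsL : s ^ L = q := by
    rw [hs, ← Real.rpow_natCast, ← Real.rpow_mul hq0.le, one_div_mul_cancel hLp.ne', Real.rpow_one]
  refine ⟨(1 + s) / 2, by linarith, by linarith, ?_⟩
  obtain ⟨r, hr⟩ : ∃ r : ℝ, r = (1 + s) / 2 := ⟨_, rfl⟩
  rw [← hr]
  have hr0 : 0 < r := by linarith
  have hr1 : r < 1 := by linarith
  obtain ⟨N1, hN1⟩ := eventually_atTop.1 (poly_exp L s r hs0 (by linarith))
  obtain ⟨N, hN⟩ : ∃ N : ℕ, N = max N1 20000 := ⟨_, rfl⟩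
  have hΔ0 : 0 ≤ ∑ n ∈ Finset.range N, (fOB n : ℝ) / r ^ n :=
    Finset.sum_nonneg (fun i _ => by positivity)
  obtain ⟨Δ, hΔ⟩ : ∃ Δ : ℝ, Δ = 1 + ∑ n ∈ Finset.range N, (fOB n : ℝ) / r ^ n := ⟨_, rfl⟩
  have hΔ1 : 1 ≤ Δ := by linarith
  refine ⟨Δ, by linarith, ?_⟩
  intro n
  induction n using Nat.strong_induction_on with
  | _ n ih =>
  intro hn1
  by_cases hnN : n < N
  · have h1 : (fOB n : ℝ) / r ^ n ≤ Δ := by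
      have := Finset.single_le_sum (f := fun n => (fOB n : ℝ) / r ^ n)
        (fun i _ => by positivity) (Finset.mem_range.2 hnN)
      linarith
    rw [div_le_iff₀ (by positivity)] at h1
    have h2 := one_le_aa n
    have h3 : 0 ≤ Δ * r ^ n := by positivity
    nlinarith
  · have hnN1 : N1 ≤ n := by omega
    have hn2 : 20000 ≤ n := by omega
    have hE := hN1 n hnN1
    have hrec := f_rec (n := n) (L := L) (M := n / 1600 + 1) (by rw [hL]; omega) (by omega) s hs35
      (by
        rw [← hq, ← hsL, ← pow_mul]
        apply pow_le_pow_of_le_one hs0.le hs1.le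
        rw [hL]; omega)
    have hb : ∀ m, 1 ≤ m → m < n → (fOB m : ℝ) ≤ 2 * Δ * aa m := by
      intro m hm hmn
      refine (ih m hmn hm).trans ?_
      have : r ^ m ≤ 1 := pow_le_one₀ hr0.le hr1.le
      have := aa_pos m
      gcongr
      nlinarith
    have e1 : (fOB (n - 1) : ℝ) * 2 ^ n ≤ 2 * Δ * aa n := by
      have h := aa_step (n - 1) (by omega)
      rw [show n - 1 + 1 = n by omega] at h
      rw [← h, ← mul_assoc]
      gcongr
      exact hb _ (by omega) (by omega)
    have e2 : (fOB (n - 2) : ℝ) * 4 ^ n ≤ 2 * Δ * (2 * aa n) := by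
      have h := aa_step2 (n - 2) (by omega)
      rw [show n - 2 + 2 = n by omega] at h
      rw [← h, ← mul_assoc]
      gcongr
      exact hb _ (by omega) (by omega)
    rw [aa_eq n hn1] at hrec
    generalize hX : s ^ n * (16 * (n : ℝ) ^ 2 * (3 * (n : ℝ) + 1) ^ (2 * L) * 10 ^ (L + 2)) = X at *
    have hX0 : 0 ≤ X := by rw [← hX]; positivity
    have ha := aa_pos n
    calc (fOB n : ℝ) ≤ aa n + X * (fOB (n - 1) * 2 ^ n + fOB (n - 2) * 4 ^ n) := hrec
      _ ≤ aa n + X * (2 * Δ * aa n + 2 * Δ * (2 * aa n)) := by gcongr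
      _ = aa n + (6 * X) * Δ * aa n := by ring
      _ ≤ aa n + r ^ n * Δ * aa n := by gcongr
      _ = (1 + Δ * r ^ n) * aa n := by ring

/-- Equation (3.12): there are constants `Δ, c > 0` with
`F(n) ≤ (1 + Δ 2^{-cn}) 2^{n(n+1)/2 - 1}` for every `n ≥ 1`. -/
theorem Fnum_upper_bound :
    ∃ Δ : ℝ, 0 < Δ ∧ ∃ c : ℝ, 0 < c ∧ ∀ n : ℕ, 1 ≤ n →
      (Fnum n : ℝ) ≤ (1 + Δ * (2 : ℝ) ^ (-(c * n))) * (2 : ℝ) ^ (n * (n + 1) / 2 - 1) := by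
  obtain ⟨r, hr0, hr1, Δ, hΔ, h⟩ := fOB_bound
  refine ⟨Δ, hΔ, -Real.logb 2 r, ?_, ?_⟩
  · have := Real.logb_neg (b := 2) (by norm_num) hr0 hr1
    linarith
  · intro n hn
    have h1 : (2 : ℝ) ^ (-(-Real.logb 2 r * n)) = r ^ n := by
      rw [neg_mul, neg_neg, Real.rpow_mul (by norm_num), Real.rpow_logb (by norm_num) (by norm_num) hr0,
        Real.rpow_natCast]
    rw [h1]
    exact le_trans (by exact_mod_cast Fnum_le n) (h n hn)
end
end
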